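/- For ℓ ≥ 2, the multiplicative submonoid of O_ℓ generated by the FRT quantum determinants det_q(X^{(1)}), …, det_q(X^{(ℓ)}) consists of regular elements and satisfies both the left and the right Ore conditions; that is, these elements generate an Ore set in O_ℓ. -/

import Mathlib

noncomputable section
open scoped BigOperators

namespace Rmatrix

/-- The base field `ℂ(q)`. -/
abbrev K : Type := RatFunc ℂ

/-- The parameter `q`. -/
def qq : K := RatFunc.X

/-- Row/column index type for `M_n ⊗ M_n`. -/
abbrev Idx (n : ℕ) := Fin n × Fin n

/-- The `R`-matrix
`R = q Σᵢ Eᵢᵢ⊗Eᵢᵢ + Σ_{i≠j} Eᵢᵢ⊗Eⱼⱼ + (q−q⁻¹) Σ_{i>j} Eⱼᵢ⊗Eᵢⱼ`. -/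
def Rm (n : ℕ) : Matrix (Idx n) (Idx n) K := fun p r =>
  (if p.1 = r.1 ∧ p.2 = r.2 ∧ p.1 = p.2 then qq else 0) +
  (if p.1 = r.1 ∧ p.2 = r.2 ∧ p.1 ≠ p.2 then 1 else 0) +
  (if p.1 = r.2 ∧ p.2 = r.1 ∧ p.1 < p.2 then qq - qq⁻¹ else 0)

/-- `R₂₁`, the `R`-matrix with the two tensor factors swapped. -/
def Rm21 (n : ℕ) : Matrix (Idx n) (Idx n) K := fun p r => Rm n (p.2, p.1) (r.2, r.1)

variable (n : ℕ) (A : Type) [Ring A] [Algebra K A]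

/-- A scalar matrix viewed as a matrix with entries in the `K`-algebra `A`. -/
def ext (M : Matrix (Idx n) (Idx n) K) : Matrix (Idx n) (Idx n) A :=
  M.map (algebraMap K A)

/-- `M₁ = Σ E_ij ⊗ I ⊗ m_ij`, the matrix `M` placed in the first tensor factor. -/
def m1 (M : Matrix (Fin n) (Fin n) A) : Matrix (Idx n) (Idx n) A :=
  fun p r => if p.2 = r.2 then M p.1 r.1 else 0

/-- `M₂ = Σ I ⊗ E_ij ⊗ m_ij`, the matrix `M` placed in the second tensor factor. -/
def m2 (M : Matrix (Fin n) (Fin n) A) : Matrix (Idx n) (Idx n) A :=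
  fun p r => if p.1 = r.1 then M p.2 r.2 else 0

/-- `Ω = Σ_{ij} E_ij ⊗ E_ji ⊗ 1`. -/
def Om : Matrix (Idx n) (Idx n) A := fun p r => if p.1 = r.2 ∧ p.2 = r.1 then 1 else 0

end Rmatrix

namespace Statement6

open Rmatrix

variable (ℓ n : ℕ)

/-- Generators `x_ij^{(a)}` of the quantized function algebra `O_ℓ`. -/
inductive Gen (ℓ n : ℕ) : Type
  | x : ZMod ℓ → Fin n → Fin n → Gen ℓ n

abbrev F (ℓ n : ℕ) := FreeAlgebra K (Gen ℓ n)

/-- The matrix `X^{(a)}` of generators, over the free algebra. -/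
def XF (a : ZMod ℓ) : Matrix (Fin n) (Fin n) (F ℓ n) :=
  fun i j => FreeAlgebra.ι K (Gen.x a i j)

/-- The defining relations of `O_ℓ` (for `ℓ ≥ 2`, including the replacement relation for
`ℓ = 2`). -/
inductive Rel (ℓ n : ℕ) : F ℓ n → F ℓ n → Prop
  | xaa (a : ZMod ℓ) (p r : Idx n) :
      Rel ℓ n ((ext n (F ℓ n) (Rm21 n) * m1 n (F ℓ n) (XF ℓ n a) * m2 n (F ℓ n) (XF ℓ n a)) p r)
              ((m2 n (F ℓ n) (XF ℓ n a) * m1 n (F ℓ n) (XF ℓ n a) * ext n (F ℓ n) (Rm n)) p r)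
  | xxadj (h : 3 ≤ ℓ) (a : ZMod ℓ) (p r : Idx n) :
      Rel ℓ n ((m1 n (F ℓ n) (XF ℓ n a) * m2 n (F ℓ n) (XF ℓ n (a - 1))) p r)
              ((m2 n (F ℓ n) (XF ℓ n (a - 1)) * ext n (F ℓ n) (Rm21 n) * m1 n (F ℓ n) (XF ℓ n a)) p r)
  | xxcom (a b : ZMod ℓ) (h : b ≠ a ∧ b ≠ a + 1 ∧ b ≠ a - 1) (p r : Idx n) :
      Rel ℓ n ((m1 n (F ℓ n) (XF ℓ n a) * m2 n (F ℓ n) (XF ℓ n b)) p r)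
              ((m2 n (F ℓ n) (XF ℓ n b) * m1 n (F ℓ n) (XF ℓ n a)) p r)
  | xxadj2 (h : ℓ = 2) (p r : Idx n) :
      Rel ℓ n ((m1 n (F ℓ n) (XF ℓ n (1 + 1)) * ext n (F ℓ n) (Rm n) * m2 n (F ℓ n) (XF ℓ n 1)) p r)
              ((m2 n (F ℓ n) (XF ℓ n 1) * ext n (F ℓ n) (Rm21 n) * m1 n (F ℓ n) (XF ℓ n (1 + 1))) p r)

/-- The quantized function algebra `O_ℓ`. -/
abbrev Ol (ℓ n : ℕ) := RingQuot (Rel ℓ n)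

/-- The generator `x_ij^{(a)}` of `O_ℓ`. -/
def xg (a : ZMod ℓ) (i j : Fin n) : Ol ℓ n :=
  RingQuot.mkAlgHom K (Rel ℓ n) (XF ℓ n a i j)

/-- The length (number of inversions) of a permutation. -/
def len (w : Equiv.Perm (Fin n)) : ℕ :=
  (Finset.univ.filter fun p : Fin n × Fin n => p.1 < p.2 ∧ w p.2 < w p.1).card

/-- The FRT quantum determinant
`det_q(X^{(a)}) = Σ_{w ∈ Σ_n} (−q)^{ℓ(w)} x^{(a)}_{w(1)1} ⋯ x^{(a)}_{w(n)n}`. -/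
def detq (a : ZMod ℓ) : Ol ℓ n :=
  ∑ w : Equiv.Perm (Fin n),
    ((-qq) ^ len n w) • (List.ofFn fun j : Fin n => xg ℓ n a (w j) j).prod

set_option linter.unusedSectionVars false

section RMatrixEntries

variable {n} {A : Type} [Ring A] [Algebra K A]

/-- The diagonal coefficient of the `R`-matrix. -/
def ca (i j : Fin n) : K := if i = j then qq else 1

/-- The off-diagonal coefficient of the `R`-matrix. -/
def cb (i j : Fin n) : K := if i < j then qq - qq⁻¹ else 0

/-- The standard `ℕ`-algebra structure on `ℂ(q)`, preferred over the one coming from `ℂ[X]`. -/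
instance natAlgebraK : Algebra ℕ K := Semiring.toNatAlgebra

/-- The standard `ℤ`-algebra structure on `ℂ(q)`, preferred over the one coming from `ℂ[X]`. -/
instance intAlgebraK : Algebra ℤ K := Ring.toIntAlgebra K

theorem qq_ne_zero : qq ≠ 0 := RatFunc.X_ne_zero

theorem ca_comm (i j : Fin n) : ca i j = ca j i := by simp [ca, eq_comm]

theorem ca_self (i : Fin n) : ca i i = qq := by simp [ca]

theorem ca_of_ne {i j : Fin n} (h : i ≠ j) : ca i j = 1 := by simp [ca, h]

theorem cb_of_lt {i j : Fin n} (h : i < j) : cb i j = qq - qq⁻¹ := by simp [cb, h]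

theorem cb_of_le {i j : Fin n} (h : j ≤ i) : cb i j = 0 := by simp [cb, not_lt.2 h]

theorem cb_self (i : Fin n) : cb i i = 0 := by simp [cb]

theorem ca_ne_zero (i j : Fin n) : ca i j ≠ 0 := by
  unfold ca; split_ifs
  · exact qq_ne_zero
  · exact one_ne_zero

theorem Rm_apply (p r : Idx n) :
    Rm n p r = (if p = r then ca p.1 p.2 else 0) + (if p = r.swap then cb p.1 p.2 else 0) := by
  obtain ⟨i, j⟩ := p
  obtain ⟨k, l⟩ := r
  simp only [Rm, ca, cb, Prod.mk.injEq, Prod.swap_prod_mk]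
  by_cases h1 : i = k <;> by_cases h2 : j = l <;> by_cases h3 : i = l <;> by_cases h4 : j = k <;>
    by_cases h5 : i = j <;> simp_all

theorem Rm21_apply (p r : Idx n) :
    Rm21 n p r = (if p = r then ca p.1 p.2 else 0) + (if p = r.swap then cb p.2 p.1 else 0) := by
  have h := Rm_apply (p.2, p.1) (r.2, r.1)
  rw [Rm21, h, ca_comm]
  congr 1
  · exact if_congr (by simp [Prod.ext_iff, and_comm]) rfl rfl
  · exact if_congr (by simp [Prod.ext_iff, and_comm]) rfl rfl

theorem ext_Rm_mul (M : Matrix (Idx n) (Idx n) A) (p r : Idx n) :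
    (ext n A (Rm n) * M) p r = ca p.1 p.2 • M p r + cb p.1 p.2 • M p.swap r := by
  simp only [Matrix.mul_apply, ext, Matrix.map_apply, ← Algebra.smul_def, Rm_apply, add_smul,
    Finset.sum_add_distrib, ite_smul, zero_smul, ← Prod.swap_eq_iff_eq_swap]
  simp

theorem ext_Rm21_mul (M : Matrix (Idx n) (Idx n) A) (p r : Idx n) :
    (ext n A (Rm21 n) * M) p r = ca p.1 p.2 • M p r + cb p.2 p.1 • M p.swap r := by
  simp only [Matrix.mul_apply, ext, Matrix.map_apply, ← Algebra.smul_def, Rm21_apply, add_smul,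
    Finset.sum_add_distrib, ite_smul, zero_smul, ← Prod.swap_eq_iff_eq_swap]
  simp

theorem mul_ext_Rm (M : Matrix (Idx n) (Idx n) A) (p r : Idx n) :
    (M * ext n A (Rm n)) p r = ca r.1 r.2 • M p r + cb r.2 r.1 • M p r.swap := by
  simp only [Matrix.mul_apply, ext, Matrix.map_apply, ← Algebra.commutes, ← Algebra.smul_def,
    Rm_apply, add_smul, Finset.sum_add_distrib, ite_smul, zero_smul]
  simp

theorem m1_apply (X : Matrix (Fin n) (Fin n) A) (p r : Idx n) :
    m1 n A X p r = if p.2 = r.2 then X p.1 r.1 else 0 := rfl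

theorem m2_apply (X : Matrix (Fin n) (Fin n) A) (p r : Idx n) :
    m2 n A X p r = if p.1 = r.1 then X p.2 r.2 else 0 := rfl

theorem m1_mul_apply (X : Matrix (Fin n) (Fin n) A) (M : Matrix (Idx n) (Idx n) A) (p r : Idx n) :
    (m1 n A X * M) p r = ∑ m, X p.1 m * M (m, p.2) r := by
  simp [Matrix.mul_apply, m1_apply, Fintype.sum_prod_type]

theorem m2_mul_apply (X : Matrix (Fin n) (Fin n) A) (M : Matrix (Idx n) (Idx n) A) (p r : Idx n) :
    (m2 n A X * M) p r = ∑ m, X p.2 m * M (p.1, m) r := by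
  simp [Matrix.mul_apply, m2_apply, Fintype.sum_prod_type]

theorem m1_mul_m2 (X Y : Matrix (Fin n) (Fin n) A) (p r : Idx n) :
    (m1 n A X * m2 n A Y) p r = X p.1 r.1 * Y p.2 r.2 := by
  simp [m1_mul_apply, m2_apply]

theorem m2_mul_m1 (X Y : Matrix (Fin n) (Fin n) A) (p r : Idx n) :
    (m2 n A Y * m1 n A X) p r = Y p.2 r.2 * X p.1 r.1 := by
  simp [m2_mul_apply, m1_apply]

theorem m1_mul (X Y : Matrix (Fin n) (Fin n) A) : m1 n A (X * Y) = m1 n A X * m1 n A Y := by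
  ext p r
  rw [m1_mul_apply, m1_apply, Matrix.mul_apply]
  simp only [m1_apply]
  split_ifs <;> simp

theorem m2_mul (X Y : Matrix (Fin n) (Fin n) A) : m2 n A (X * Y) = m2 n A X * m2 n A Y := by
  ext p r
  rw [m2_mul_apply, m2_apply, Matrix.mul_apply]
  simp only [m2_apply]
  split_ifs <;> simp

theorem m2_add (X Y : Matrix (Fin n) (Fin n) A) : m2 n A (X + Y) = m2 n A X + m2 n A Y := by
  ext p r
  simp only [m2_apply, Matrix.add_apply]
  split_ifs <;> simp

theorem m1_one : m1 n A 1 = 1 := by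
  ext ⟨i, j⟩ ⟨k, l⟩
  simp only [m1_apply, Matrix.one_apply, Prod.mk.injEq]
  split_ifs <;> simp_all

theorem m2_one : m2 n A 1 = 1 := by
  ext ⟨i, j⟩ ⟨k, l⟩
  simp only [m2_apply, Matrix.one_apply, Prod.mk.injEq]
  split_ifs <;> simp_all

theorem m1_commute_m2 {X Y : Matrix (Fin n) (Fin n) A}
    (h : ∀ i j k l, X i j * Y k l = Y k l * X i j) :
    m1 n A X * m2 n A Y = m2 n A Y * m1 n A X := by
  ext p r
  rw [m1_mul_m2, m2_mul_m1, h]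

/-- The entry of `X₁ R Y₂`. -/
theorem m1_Rm_m2 (X Y : Matrix (Fin n) (Fin n) A) (p r : Idx n) :
    (m1 n A X * ext n A (Rm n) * m2 n A Y) p r =
      ca p.2 r.1 • (X p.1 r.1 * Y p.2 r.2) +
        if p.2 = r.1 then ∑ m, cb m p.2 • (X p.1 m * Y m r.2) else 0 := by
  obtain ⟨i, j⟩ := p
  obtain ⟨k, l⟩ := r
  rw [Matrix.mul_assoc, m1_mul_apply]
  simp only [ext_Rm_mul, m2_apply, Prod.swap_prod_mk, mul_add, mul_smul_comm, mul_ite, mul_zero,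
    smul_ite, smul_zero, Finset.sum_add_distrib]
  simp [ca_comm]

/-- The entry of `Y₂ R₂₁ X₁`. -/
theorem m2_Rm21_m1 (X Y : Matrix (Fin n) (Fin n) A) (p r : Idx n) :
    (m2 n A Y * ext n A (Rm21 n) * m1 n A X) p r =
      ca p.1 r.2 • (Y p.2 r.2 * X p.1 r.1) +
        if p.1 = r.2 then ∑ m, cb m p.1 • (Y p.2 m * X m r.1) else 0 := by
  obtain ⟨i, j⟩ := p
  obtain ⟨k, l⟩ := r
  rw [Matrix.mul_assoc, m2_mul_apply]
  simp only [ext_Rm21_mul, m1_apply, Prod.swap_prod_mk, mul_add, mul_smul_comm, mul_ite, mul_zero,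
    smul_ite, smul_zero, Finset.sum_add_distrib]
  simp

/-- The relation `R₂₁ X₁ X₂ = X₂ X₁ R`, entry by entry. -/
def FRT (X : Matrix (Fin n) (Fin n) A) : Prop := ∀ i j k l,
  ca i j • (X i k * X j l) + cb j i • (X j k * X i l) =
    ca k l • (X j l * X i k) + cb l k • (X j k * X i l)

theorem frt_iff (X : Matrix (Fin n) (Fin n) A) :
    ext n A (Rm21 n) * m1 n A X * m2 n A X = m2 n A X * m1 n A X * ext n A (Rm n) ↔ FRT X := by
  rw [← Matrix.ext_iff]
  simp only [Prod.forall, Matrix.mul_assoc (ext n A (Rm21 n)), ext_Rm21_mul, mul_ext_Rm,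
    m1_mul_m2, m2_mul_m1, Prod.swap_prod_mk]
  rfl

end RMatrixEntries

section Relations

variable {ℓ n} {A B : Type} [Ring A] [Algebra K A] [Ring B] [Algebra K B]

theorem map_ext (f : A →ₐ[K] B) (M : Matrix (Idx n) (Idx n) K) :
    (ext n A M).map f = ext n B M := by
  ext p r
  simp [ext]

theorem map_m1 (f : A →ₐ[K] B) (X : Matrix (Fin n) (Fin n) A) :
    (m1 n A X).map f = m1 n B (X.map f) := by
  ext p r
  simp only [Matrix.map_apply, m1_apply]
  split_ifs <;> simp

theorem map_m2 (f : A →ₐ[K] B) (X : Matrix (Fin n) (Fin n) A) :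
    (m2 n A X).map f = m2 n B (X.map f) := by
  ext p r
  simp only [Matrix.map_apply, m2_apply]
  split_ifs <;> simp

/-- A family of matrices satisfying the defining relations of `O_ℓ`. -/
structure IsRep (X : ZMod ℓ → Matrix (Fin n) (Fin n) A) : Prop where
  frt (a : ZMod ℓ) :
    ext n A (Rm21 n) * m1 n A (X a) * m2 n A (X a) = m2 n A (X a) * m1 n A (X a) * ext n A (Rm n)
  adj (h : 3 ≤ ℓ) (a : ZMod ℓ) :
    m1 n A (X a) * m2 n A (X (a - 1)) = m2 n A (X (a - 1)) * ext n A (Rm21 n) * m1 n A (X a)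
  com (a b : ZMod ℓ) (h : b ≠ a ∧ b ≠ a + 1 ∧ b ≠ a - 1) :
    m1 n A (X a) * m2 n A (X b) = m2 n A (X b) * m1 n A (X a)
  adj2 (h : ℓ = 2) :
    m1 n A (X (1 + 1)) * ext n A (Rm n) * m2 n A (X 1) =
      m2 n A (X 1) * ext n A (Rm21 n) * m1 n A (X (1 + 1))

/-- The matrix of generators of `O_ℓ`. -/
def Xm (ℓ n : ℕ) (a : ZMod ℓ) : Matrix (Fin n) (Fin n) (Ol ℓ n) := fun i j => xg ℓ n a i j

theorem map_XF_mkAlgHom (a : ZMod ℓ) :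
    (XF ℓ n a).map (RingQuot.mkAlgHom K (Rel ℓ n)) = Xm ℓ n a := rfl

theorem isRep_Xm : IsRep (Xm ℓ n) := by
  have key : ∀ {M N : Matrix (Idx n) (Idx n) (F ℓ n)}, (∀ p r, Rel ℓ n (M p r) (N p r)) →
      M.map (RingQuot.mkAlgHom K (Rel ℓ n)) = N.map (RingQuot.mkAlgHom K (Rel ℓ n)) := by
    intro M N h
    ext p r
    exact RingQuot.mkAlgHom_rel K (h p r)
  constructor
  · intro a
    have h := key (Rel.xaa (n := n) a)
    simpa only [Matrix.map_mul, map_ext, map_m1, map_m2, map_XF_mkAlgHom] using h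
  · intro hl a
    have h := key (Rel.xxadj (n := n) hl a)
    simpa only [Matrix.map_mul, map_ext, map_m1, map_m2, map_XF_mkAlgHom] using h
  · intro a b hab
    have h := key (Rel.xxcom (n := n) a b hab)
    simpa only [Matrix.map_mul, map_ext, map_m1, map_m2, map_XF_mkAlgHom] using h
  · intro hl
    have h := key (Rel.xxadj2 (n := n) hl)
    simpa only [Matrix.map_mul, map_ext, map_m1, map_m2, map_XF_mkAlgHom] using h

/-- The image of a generator in the free algebra under the map attached to a family `X`. -/
def genVal (X : ZMod ℓ → Matrix (Fin n) (Fin n) A) : Gen ℓ n → A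
  | Gen.x a i j => X a i j

theorem map_XF_lift (X : ZMod ℓ → Matrix (Fin n) (Fin n) A) (a : ZMod ℓ) :
    (XF ℓ n a).map (FreeAlgebra.lift K (genVal X)) = X a := by
  ext i j
  simp [XF, genVal]

/-- The universal property of `O_ℓ`. -/
def IsRep.lift {X : ZMod ℓ → Matrix (Fin n) (Fin n) A} (hX : IsRep X) : Ol ℓ n →ₐ[K] A :=
  RingQuot.liftAlgHom K ⟨FreeAlgebra.lift K (genVal X), by
    have key : ∀ {M N : Matrix (Idx n) (Idx n) (F ℓ n)} (p r : Idx n),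
        M.map (FreeAlgebra.lift K (genVal X)) = N.map (FreeAlgebra.lift K (genVal X)) →
        FreeAlgebra.lift K (genVal X) (M p r) = FreeAlgebra.lift K (genVal X) (N p r) :=
      fun p r h => congrFun (congrFun h p) r
    intro x y h
    cases h with
    | xaa a p r =>
      apply key
      simpa only [Matrix.map_mul, map_ext, map_m1, map_m2, map_XF_lift] using hX.frt a
    | xxadj hl a p r =>
      apply key
      simpa only [Matrix.map_mul, map_ext, map_m1, map_m2, map_XF_lift] using hX.adj hl a
    | xxcom a b hab p r =>
      apply key
      simpa only [Matrix.map_mul, map_ext, map_m1, map_m2, map_XF_lift] using hX.com a b hab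
    | xxadj2 hl p r =>
      apply key
      simpa only [Matrix.map_mul, map_ext, map_m1, map_m2, map_XF_lift] using hX.adj2 hl⟩

theorem IsRep.lift_xg {X : ZMod ℓ → Matrix (Fin n) (Fin n) A} (hX : IsRep X)
    (a : ZMod ℓ) (i j : Fin n) : hX.lift (xg ℓ n a i j) = X a i j := by
  simp [IsRep.lift, xg, XF, genVal]

theorem adjoin_xg :
    Algebra.adjoin K (Set.range fun g : ZMod ℓ × Fin n × Fin n => xg ℓ n g.1 g.2.1 g.2.2) = ⊤ := by
  have h := congrArg (Subalgebra.map (RingQuot.mkAlgHom K (Rel ℓ n)))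
    (FreeAlgebra.adjoin_range_ι K (Gen ℓ n))
  rw [AlgHom.map_adjoin, Algebra.map_top,
    (AlgHom.range_eq_top _).2 (RingQuot.mkAlgHom_surjective K (Rel ℓ n))] at h
  rw [← h]
  congr 1
  ext y
  constructor
  · rintro ⟨⟨a, i, j⟩, rfl⟩
    exact ⟨_, ⟨Gen.x a i j, rfl⟩, rfl⟩
  · rintro ⟨_, ⟨⟨a, i, j⟩, rfl⟩, rfl⟩
    exact ⟨(a, i, j), rfl⟩

end Relations

section QExterior

variable {n} {E : Type} [Ring E] [Algebra K E]

/-- Elements satisfying the relations of a quantum exterior algebra. -/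
structure QExt (c : K) (η : Fin n → E) : Prop where
  sq (i : Fin n) : η i * η i = 0
  comm {i j : Fin n} (h : i < j) : η j * η i = c • (η i * η j)

variable {c : K} {η : Fin n → E}

theorem QExt.exists_comm (h : QExt c η) (hc : c ≠ 0) (i j : Fin n) :
    ∃ u : K, η i * η j = u • (η j * η i) := by
  rcases lt_trichotomy i j with hij | rfl | hij
  · exact ⟨c⁻¹, by rw [h.comm hij, smul_smul, inv_mul_cancel₀ hc, one_smul]⟩
  · exact ⟨1, by simp⟩
  · exact ⟨c, h.comm hij⟩

theorem QExt.mul_prod_eq_zero (h : QExt c η) (hc : c ≠ 0) {k : Fin n} {l : List (Fin n)}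
    (hk : k ∈ l) : η k * (l.map η).prod = 0 := by
  induction l with
  | nil => simp at hk
  | cons a t ih =>
    rw [List.map_cons, List.prod_cons, ← mul_assoc]
    rcases List.mem_cons.1 hk with rfl | hk
    · rw [h.sq, zero_mul]
    · obtain ⟨u, hu⟩ := h.exists_comm hc k a
      rw [hu, smul_mul_assoc, mul_assoc, ih hk, mul_zero, smul_zero]

theorem QExt.prod_mul_eq_zero (h : QExt c η) (hc : c ≠ 0) {k : Fin n} {l : List (Fin n)}
    (hk : k ∈ l) : (l.map η).prod * η k = 0 := by
  induction l using List.reverseRecOn with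
  | nil => simp at hk
  | append_singleton t a ih =>
    rw [List.map_append, List.prod_append, List.map_singleton, List.prod_singleton, mul_assoc]
    rcases List.mem_append.1 hk with hk | hk
    · obtain ⟨u, hu⟩ := h.exists_comm hc a k
      rw [hu, mul_smul_comm, ← mul_assoc, ih hk, zero_mul, smul_zero]
    · rw [List.mem_singleton.1 hk, h.sq, mul_zero]

theorem QExt.prod_eq_zero_of_not_nodup (h : QExt c η) (hc : c ≠ 0) {l : List (Fin n)}
    (hl : ¬ l.Nodup) : (l.map η).prod = 0 := by
  induction l with
  | nil => simp at hl
  | cons a t ih =>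
    rw [List.map_cons, List.prod_cons]
    by_cases ha : a ∈ t
    · exact h.mul_prod_eq_zero hc ha
    · rw [ih (fun ht => hl (List.nodup_cons.2 ⟨ha, ht⟩)), mul_zero]

/-- The number of inversions of a list. -/
def listInv : List (Fin n) → ℕ
  | [] => 0
  | a :: t => t.countP (· < a) + listInv t

theorem QExt.mul_prod_orderedInsert (h : QExt c η) {k : Fin n} {l : List (Fin n)}
    (hs : l.Pairwise (· ≤ ·)) (hk : k ∉ l) :
    η k * (l.map η).prod = c ^ l.countP (· < k) • ((l.orderedInsert (· ≤ ·) k).map η).prod := by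
  induction l with
  | nil => simp
  | cons a t ih =>
    rw [List.pairwise_cons] at hs
    by_cases hka : k ≤ a
    · rw [List.orderedInsert_cons_of_le _ _ hka, List.countP_eq_zero.2]
      · simp
      · intro b hb
        rcases List.mem_cons.1 hb with rfl | hb
        · simpa using hka
        · simpa using hka.trans (hs.1 b hb)
    · have hak : a < k := not_le.1 hka
      rw [List.orderedInsert_of_not_le _ _ hka, List.countP_cons_of_pos (by simpa using hak),
        List.map_cons, List.map_cons, List.prod_cons, List.prod_cons, ← mul_assoc, h.comm hak,
        smul_mul_assoc, mul_assoc, ih hs.2 (fun hm => hk (List.mem_cons_of_mem _ hm)),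
        mul_smul_comm, smul_smul, pow_succ']

theorem QExt.prod_insertionSort (h : QExt c η) {l : List (Fin n)} (hl : l.Nodup) :
    (l.map η).prod = c ^ listInv l • ((l.insertionSort (· ≤ ·)).map η).prod := by
  induction l with
  | nil => simp [listInv]
  | cons a t ih =>
    rw [List.nodup_cons] at hl
    have hcount : (t.insertionSort (· ≤ ·)).countP (· < a) = t.countP (· < a) :=
      (List.perm_insertionSort (· ≤ ·) t).countP_eq _
    rw [List.map_cons, List.prod_cons, ih hl.2, mul_smul_comm,
      h.mul_prod_orderedInsert (List.pairwise_insertionSort _ _)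
        (fun hm => hl.1 ((List.perm_insertionSort (· ≤ ·) t).mem_iff.1 hm)),
      smul_smul, ← pow_add, hcount, listInv, add_comm, List.insertionSort_cons]

theorem listInv_ofFn {m : ℕ} (w : Fin m → Fin n) :
    listInv (List.ofFn w) =
      (Finset.univ.filter fun p : Fin m × Fin m => p.1 < p.2 ∧ w p.2 < w p.1).card := by
  induction m with
  | zero => simp [listInv]
  | succ m ih =>
    rw [List.ofFn_succ, listInv, ih]
    simp only [Finset.card_filter, Fintype.sum_prod_type, Fin.sum_univ_succ]
    simp only [lt_self_iff_false, false_and, if_false, zero_add, Fin.succ_pos, true_and,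
      Fin.not_lt_zero, Fin.succ_lt_succ_iff]
    congr 1
    rw [← Finset.card_filter]
    clear ih
    have : ∀ (k : ℕ) (v : Fin k → Fin n) (a : Fin n), (List.ofFn v).countP (· < a) =
        (Finset.univ.filter fun i => v i < a).card := by
      intro k v a
      induction k with
      | zero => simp
      | succ k ih =>
        rw [List.ofFn_succ, List.countP_cons, ih, Finset.card_filter, Finset.card_filter,
          Fin.sum_univ_succ, add_comm]
        simp
    exact this _ _ _

theorem QExt.prod_perm (h : QExt c η) (w : Equiv.Perm (Fin n)) :
    (List.ofFn fun j => η (w j)).prod = c ^ len n w • (List.ofFn η).prod := by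
  have h1 := h.prod_insertionSort (l := List.ofFn w) (List.nodup_ofFn.2 w.injective)
  have h2 : (List.ofFn w).insertionSort (· ≤ ·) = List.finRange n := by
    refine List.Perm.eq_of_pairwise (le := (· ≤ ·)) (fun a b _ _ => le_antisymm)
      (List.pairwise_insertionSort _ _) ?_
      ((List.perm_insertionSort _ _).trans ?_)
    · exact (List.pairwise_lt_finRange n).imp le_of_lt
    · rw [List.perm_ext_iff_of_nodup (List.nodup_ofFn.2 w.injective) (List.nodup_finRange n)]
      intro a
      simp [List.mem_ofFn, w.surjective a]
  rw [h2, listInv_ofFn, List.map_ofFn, ← List.ofFn_eq_map] at h1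
  exact h1

theorem QExt.prod_of_not_injective (h : QExt c η) (hc : c ≠ 0) {w : Fin n → Fin n}
    (hw : ¬ Function.Injective w) : (List.ofFn fun j => η (w j)).prod = 0 := by
  have := h.prod_eq_zero_of_not_nodup hc (l := List.ofFn w) (fun h => hw (List.nodup_ofFn.1 h))
  rwa [List.map_ofFn] at this

/-- The quantum determinant of a matrix. -/
def qdet {A : Type} [Ring A] [Algebra K A] (M : Matrix (Fin n) (Fin n) A) : A :=
  ∑ w : Equiv.Perm (Fin n), ((-qq) ^ len n w) • (List.ofFn fun j : Fin n => M (w j) j).prod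

theorem prod_ofFn_mul_of_commute {m : ℕ} (f g : Fin m → E) (h : ∀ i j, Commute (g i) (f j)) :
    (List.ofFn fun j => f j * g j).prod = (List.ofFn f).prod * (List.ofFn g).prod := by
  induction m with
  | zero => simp
  | succ m ih =>
    simp only [List.ofFn_succ, List.prod_cons]
    rw [ih _ _ (fun i j => h _ _)]
    have : Commute (g 0) (List.ofFn fun i : Fin m => f i.succ).prod := by
      apply Commute.list_prod_right
      intro y hy
      obtain ⟨j, rfl⟩ := List.mem_ofFn.1 hy
      exact h _ _
    rw [mul_assoc, ← mul_assoc (g 0), this.eq]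
    simp only [mul_assoc]

/-- The quantum determinant as a coefficient of the top form. -/
theorem QExt.prod_sum_eq {A : Type} [Ring A] [Algebra K A] (ι : A →ₐ[K] E)
    (h : QExt (-qq) η) (hι : ∀ i y, Commute (η i) (ι y)) (M : Matrix (Fin n) (Fin n) A) :
    (List.ofFn fun j => ∑ i, η i * ι (M i j)).prod = (List.ofFn η).prod * ι (qdet M) := by
  have h1 := (MultilinearMap.mkPiAlgebraFin K n E).map_sum
    (fun (j : Fin n) (i : Fin n) => η i * ι (M i j))
  simp only [MultilinearMap.mkPiAlgebraFin_apply] at h1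
  rw [h1]
  have h2 : ∀ r : Fin n → Fin n, (List.ofFn fun j => η (r j) * ι (M (r j) j)).prod =
      (List.ofFn fun j => η (r j)).prod * ι (List.ofFn fun j => M (r j) j).prod := by
    intro r
    rw [prod_ofFn_mul_of_commute (fun j => η (r j)) (fun j => ι (M (r j) j))
      (fun i j => (hι _ _).symm), map_list_prod, List.map_ofFn]
    rfl
  simp only [h2]
  rw [qdet, map_sum, Finset.mul_sum]
  have hc : (-qq : K) ≠ 0 := neg_ne_zero.2 qq_ne_zero
  have h3 : ∀ r ∈ (Finset.univ : Finset (Fin n → Fin n)),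
      r ∉ Finset.univ.image (fun w : Equiv.Perm (Fin n) => (w : Fin n → Fin n)) →
      (List.ofFn fun j => η (r j)).prod * ι (List.ofFn fun j => M (r j) j).prod = 0 := by
    intro r _ hr
    rw [h.prod_of_not_injective hc, zero_mul]
    intro hi
    exact hr (Finset.mem_image.2
      ⟨Equiv.ofBijective r (Finite.injective_iff_bijective.1 hi), Finset.mem_univ _, rfl⟩)
  rw [← Finset.sum_subset (Finset.subset_univ _) h3,
    Finset.sum_image (fun a _ b _ hab => Equiv.coe_fn_injective hab)]
  refine Finset.sum_congr rfl fun w _ => ?_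
  rw [h.prod_perm w, map_smul, mul_smul_comm, smul_mul_assoc]

end QExterior

section Fock

variable {n}

/-- The creation operators on the quantum exterior algebra. -/
def fockK (i : Fin n) : Matrix (Finset (Fin n)) (Finset (Fin n)) K := fun T S =>
  if i ∉ S ∧ T = insert i S then (-qq) ^ (S.filter (· < i)).card else 0

theorem mul_fockK (M : Matrix (Finset (Fin n)) (Finset (Fin n)) K) (i : Fin n)
    (T S : Finset (Fin n)) :
    (M * fockK i) T S =
      if i ∈ S then 0 else M T (insert i S) * (-qq) ^ (S.filter (· < i)).card := by
  by_cases h : i ∈ S <;> simp [Matrix.mul_apply, fockK, h]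

theorem fockK_qExt : QExt (-qq) (fockK (n := n)) := by
  constructor
  · intro i
    ext T S
    rw [mul_fockK]
    simp [fockK]
  · intro i j hij
    ext T S
    rw [Matrix.smul_apply, mul_fockK, mul_fockK]
    by_cases hi : i ∈ S
    · simp [fockK, hi]
    by_cases hj : j ∈ S
    · simp [fockK, hj]
    simp only [fockK, hi, hj, Finset.mem_insert, hij.ne, hij.ne', or_self, not_false_eq_true,
      true_and, if_false, Finset.insert_comm j i, smul_eq_mul]
    split_ifs
    · rw [Finset.filter_insert, if_pos hij, Finset.filter_insert, if_neg (not_lt.2 hij.le),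
        Finset.card_insert_of_notMem (by simp [hi])]
      ring
    · simp

theorem fockK_prod_apply {l : List (Fin n)} (T S : Finset (Fin n))
    (hl : l.Pairwise (· < ·)) (hS : ∀ i ∈ l, ∀ s ∈ S, i < s) :
    (l.map fockK).prod T S = if T = l.toFinset ∪ S then 1 else 0 := by
  induction l using List.reverseRecOn generalizing S with
  | nil => simp [Matrix.one_apply]
  | append_singleton t a ih =>
    rw [List.pairwise_append] at hl
    rw [List.map_append, List.prod_append, List.map_singleton, List.prod_singleton, mul_fockK,
      if_neg (fun ha => lt_irrefl _ (hS a (by simp) a ha)), ih _ hl.1]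
    · have : S.filter (· < a) = ∅ :=
        Finset.filter_eq_empty_iff.2 fun s hs => not_lt.2 (hS a (by simp) s hs).le
      rw [this, Finset.card_empty, pow_zero, mul_one]
      congr 2
      ext x
      simp
    · intro i hi s hs
      rcases Finset.mem_insert.1 hs with rfl | hs
      · exact hl.2.2 i hi _ (by simp)
      · exact hS i (by simp [hi]) s hs

theorem fockK_prod : (List.ofFn (fockK (n := n))).prod Finset.univ ∅ = 1 := by
  rw [List.ofFn_eq_map, fockK_prod_apply _ _ (List.pairwise_lt_finRange n) (by simp)]
  simp

variable (n) (A : Type) [Ring A] [Algebra K A]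

/-- The algebra of matrices over `A` acting on the quantum exterior algebra. -/
abbrev Fock := Matrix (Finset (Fin n)) (Finset (Fin n)) A

/-- The creation operators with coefficients extended to `A`. -/
def fock (i : Fin n) : Fock n A := (fockK i).map (algebraMap K A)

theorem fock_qExt : QExt (-qq) (fock n A) := by
  have key : ∀ i j, fock n A i * fock n A j = (fockK i * fockK j).map (algebraMap K A) :=
    fun i j => (Matrix.map_mul (f := algebraMap K A)).symm
  constructor
  · intro i
    rw [key, fockK_qExt.sq, Matrix.map_zero _ (map_zero _)]
  · intro i j hij
    rw [key, key, fockK_qExt.comm hij]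
    ext T S
    rw [Matrix.map_apply, Matrix.smul_apply, Matrix.smul_apply, Matrix.map_apply, smul_eq_mul,
      map_mul, Algebra.smul_def]

theorem fock_commute (i : Fin n) (y : A) :
    Commute (fock n A i) (Matrix.scalarAlgHom (Finset (Fin n)) K y) := by
  ext T S
  simp [fock, Algebra.commutes]

theorem fock_prod_cancel {y z : A}
    (h : (List.ofFn (fock n A)).prod * Matrix.scalarAlgHom (Finset (Fin n)) K y =
      (List.ofFn (fock n A)).prod * Matrix.scalarAlgHom (Finset (Fin n)) K z) : y = z := by
  have h1 : (List.ofFn (fock n A)).prod = (List.ofFn (fockK (n := n))).prod.map (algebraMap K A) := by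
    have := map_list_prod (algebraMap K A).mapMatrix (List.ofFn (fockK (n := n)))
    rw [List.map_ofFn] at this
    exact this.symm
  have h2 := congrFun (congrFun h Finset.univ) ∅
  simpa [h1, fockK_prod] using h2

end Fock

section Jump

variable {n} {E : Type} [Ring E] [Algebra K E] {c : K} {η : Fin n → E}

/-- Left multiplication by the `R`-matrix on exterior elements, jumping to larger indices. -/
def jumpUp (η : Fin n → E) (i : Fin n) : Matrix (Fin n) (Fin n) E := fun a b =>
  (if a = b then ca i a • η i else 0) + (if a = i then cb i b • η b else 0)

/-- Left multiplication by the `R`-matrix on exterior elements, jumping to smaller indices. -/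
def jumpDown (η : Fin n → E) (i : Fin n) : Matrix (Fin n) (Fin n) E := fun a b =>
  (if a = b then ca i a • η i else 0) + (if a = i then cb b i • η b else 0)

theorem jumpUp_mul (i : Fin n) (M : Matrix (Fin n) (Fin n) E) (a b : Fin n) :
    (jumpUp η i * M) a b =
      ca i a • (η i * M a b) + if a = i then ∑ m, cb i m • (η m * M m b) else 0 := by
  simp only [Matrix.mul_apply, jumpUp, add_mul, ite_mul, zero_mul, smul_mul_assoc,
    Finset.sum_add_distrib]
  split_ifs <;> simp

theorem mul_jumpUp (i : Fin n) (M : Matrix (Fin n) (Fin n) E) (a b : Fin n) :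
    (M * jumpUp η i) a b = ca i b • (M a b * η i) + cb i b • (M a i * η b) := by
  simp [Matrix.mul_apply, jumpUp, mul_add, Finset.sum_add_distrib]

theorem jumpDown_mul (i : Fin n) (M : Matrix (Fin n) (Fin n) E) (a b : Fin n) :
    (jumpDown η i * M) a b =
      ca i a • (η i * M a b) + if a = i then ∑ m, cb m i • (η m * M m b) else 0 := by
  simp only [Matrix.mul_apply, jumpDown, add_mul, ite_mul, zero_mul, smul_mul_assoc,
    Finset.sum_add_distrib]
  split_ifs <;> simp

theorem mul_jumpDown (i : Fin n) (M : Matrix (Fin n) (Fin n) E) (a b : Fin n) :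
    (M * jumpDown η i) a b = ca i b • (M a b * η i) + cb b i • (M a i * η b) := by
  simp [Matrix.mul_apply, jumpDown, mul_add, Finset.sum_add_distrib]

theorem prod_jumpUp_apply (h : QExt c η) (hc : c ≠ 0) {l : List (Fin n)} (hl : l.Nodup)
    (hl' : l.Pairwise (· < ·)) (hup : ∀ i ∈ l, ∀ b, i < b → b ∈ l) (a b : Fin n) :
    (l.map (jumpUp η)).prod a b =
      if a = b then (if a ∈ l then qq else 1) • (l.map η).prod else 0 := by
  induction l generalizing a b with
  | nil => simp [Matrix.one_apply]
  | cons i t ih =>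
    rw [List.nodup_cons] at hl
    rw [List.pairwise_cons] at hl'
    have hup' : ∀ b, i < b → b ∈ t := fun b hb =>
      (List.mem_cons.1 (hup i (by simp) b hb)).resolve_left hb.ne'
    have ih := ih hl.2 hl'.2 fun j hj b hb => hup' b ((hl'.1 j hj).trans hb)
    rw [List.map_cons, List.prod_cons, jumpUp_mul, List.map_cons, List.prod_cons]
    have hz : ∑ m, cb i m • (η m * (t.map (jumpUp η)).prod m b) = 0 := by
      refine Finset.sum_eq_zero fun m _ => ?_
      rw [ih]
      by_cases him : i < m
      · split_ifs <;> simp [h.mul_prod_eq_zero hc (hup' m him)]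
      · rw [cb_of_le (not_lt.1 him), zero_smul]
    rw [hz, ite_self, add_zero, ih]
    by_cases hab : a = b
    · subst hab
      by_cases hai : a = i
      · subst hai
        simp [hl.1, ca_self]
      · simp [hai, ca_of_ne (Ne.symm hai)]
    · simp [hab]

theorem prod_jumpDown_apply (h : QExt c η) (hc : c ≠ 0) {l : List (Fin n)} (hl : l.Nodup)
    (hl' : l.Pairwise (· < ·)) (hdown : ∀ i ∈ l, ∀ b, b < i → b ∈ l) (a b : Fin n) :
    (l.map (jumpDown η)).prod a b =
      if a = b then (if a ∈ l then qq else 1) • (l.map η).prod else 0 := by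
  induction l using List.reverseRecOn generalizing a b with
  | nil => simp [Matrix.one_apply]
  | append_singleton t i ih =>
    have hit : i ∉ t := fun hi => by
      simpa [hi] using (List.nodup_append.1 hl).2.2 i hi i
    rw [List.pairwise_append] at hl'
    have hdown' : ∀ b, b < i → b ∈ t := fun b hb => by
      have := hdown i (by simp) b hb
      simpa [hb.ne] using this
    have ih := ih (List.nodup_append.1 hl).1 hl'.1 fun j hj b hb =>
      hdown' b (hb.trans (hl'.2.2 j hj i (by simp)))
    rw [List.map_append, List.prod_append, List.map_singleton, List.prod_singleton, mul_jumpDown,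
      List.map_append, List.prod_append, List.map_singleton, List.prod_singleton, ih, ih]
    have hz : cb b i • ((if a = i then (if a ∈ t then qq else (1 : K)) • (t.map η).prod else 0) *
        η b) = 0 := by
      by_cases hbi : b < i
      · split_ifs <;> simp [h.prod_mul_eq_zero hc (hdown' b hbi)]
      · rw [cb_of_le (not_lt.1 hbi), zero_smul]
    rw [hz, add_zero]
    by_cases hab : a = b
    · subst hab
      by_cases hai : a = i
      · subst hai
        simp [hit, ca_self]
      · simp [hai, ca_of_ne (Ne.symm hai)]
    · simp [hab]

theorem prod_jumpUp (h : QExt c η) (hc : c ≠ 0) :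
    (List.ofFn (jumpUp η)).prod = qq • Matrix.scalar (Fin n) (List.ofFn η).prod := by
  ext a b
  rw [List.ofFn_eq_map, prod_jumpUp_apply h hc (List.nodup_finRange n)
    (List.pairwise_lt_finRange n) (by simp), List.ofFn_eq_map]
  simp [Matrix.diagonal_apply]

theorem prod_jumpDown (h : QExt c η) (hc : c ≠ 0) :
    (List.ofFn (jumpDown η)).prod = qq • Matrix.scalar (Fin n) (List.ofFn η).prod := by
  ext a b
  rw [List.ofFn_eq_map, prod_jumpDown_apply h hc (List.nodup_finRange n)
    (List.pairwise_lt_finRange n) (by simp), List.ofFn_eq_map]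
  simp [Matrix.diagonal_apply]

theorem jumpUp_mul_jumpUp (i j a b : Fin n) :
    (jumpUp η i * jumpUp η j) a b =
      (if a = b then (ca i a * ca j a) • (η i * η j) else 0) +
      (if a = j then (ca i a * cb j b) • (η i * η b) else 0) +
      (if a = i then (cb i b * ca j b) • (η b * η j) else 0) +
      (if a = i then (cb i j * cb j b) • (η j * η b) else 0) := by
  rw [mul_jumpUp]
  simp only [jumpUp, add_mul, ite_mul, zero_mul, smul_add, smul_ite, smul_mul_assoc, smul_smul,
    smul_zero]
  split_ifs <;> simp_all [mul_comm] <;> abel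

theorem jumpUp_qExt (h : QExt (-qq) η) : QExt (-qq) (jumpUp η) := by
  have hq := qq_ne_zero
  constructor
  · intro i
    ext a b
    rw [jumpUp_mul_jumpUp, h.sq, cb_self]
    by_cases hai : a = i
    · subst hai
      rcases lt_or_ge a b with hab | hab
      · simp only [h.comm hab, Matrix.zero_apply, smul_zero, ite_self, zero_add, zero_mul, zero_smul,
          add_zero, if_true, smul_smul, ← add_smul, ca_self, ca_of_ne hab.ne, cb_of_lt hab]
        ring_nf
        simp
      · simp [cb_of_le hab]
    · simp [hai]
  · intro i j hij
    ext a b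
    rw [Matrix.smul_apply, jumpUp_mul_jumpUp, jumpUp_mul_jumpUp, h.comm hij]
    by_cases hai : a = i
    · subst hai
      rcases lt_trichotomy a b with hab | rfl | hab
      · rcases lt_trichotomy b j with hbj | rfl | hbj
        · simp only [hij.ne, hab.ne, hbj.ne', hij.ne', ca, cb, hij, hab, not_lt.2 hbj.le,
            not_lt.2 hij.le, if_true, if_false, h.comm hbj, h.comm hab]
          match_scalars <;> (field_simp; ring)
        · simp only [hij.ne, hij.ne', ca, cb, hij, not_lt.2 hij.le, lt_irrefl, if_true, if_false,
            h.comm hij, h.sq]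
          match_scalars
        · simp only [hij.ne, hab.ne, hbj.ne, hij.ne', ca, cb, hij, hab, hbj,
            not_lt.2 hij.le, if_true, if_false, h.comm hbj, h.comm hab]
          match_scalars <;> (field_simp; ring)
      · simp only [hij.ne, hij.ne', ca, cb, hij, not_lt.2 hij.le, lt_irrefl, if_true, if_false]
        match_scalars <;> (field_simp; ring)
      · simp [hij.ne, hab.ne', ca, cb, not_lt.2 hab.le, (hab.trans hij).not_gt]
    by_cases haj : a = j
    · subst haj
      rcases lt_trichotomy a b with hab | rfl | hab
      · simp only [hij.ne, hij.ne', hab.ne, ca, cb, hij, hab, (hij.trans hab), (hij.trans hab).ne,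
          not_lt.2 hij.le, if_true, if_false, h.comm hab, h.comm (hij.trans hab)]
        match_scalars <;> (field_simp; ring)
      · simp only [hij.ne, hij.ne', ca, cb, hij, not_lt.2 hij.le, lt_irrefl, if_true, if_false]
        match_scalars <;> field_simp <;> ring
      · simp [hij.ne', hab.ne', ca, cb, not_lt.2 hij.le, not_lt.2 hab.le]
    · by_cases hab : a = b
      · subst hab
        simp [hai, haj, smul_smul, ca_of_ne (Ne.symm hai), ca_of_ne (Ne.symm haj)]
      · simp [hai, haj, hab]

end Jump

section Normality

variable {n} {A E : Type} [Ring A] [Algebra K A] [Ring E] [Algebra K E]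
  {η : Fin n → E} {ι : A →ₐ[K] E} {M X : Matrix (Fin n) (Fin n) A}

/-- The one-forms attached to the columns of a matrix. -/
def form (η : Fin n → E) (ι : A →ₐ[K] E) (M : Matrix (Fin n) (Fin n) A) (k : Fin n) : E :=
  ∑ i, η i * ι (M i k)

/-- The one-forms attached to the columns of a matrix, built on `jumpUp η`. -/
def formUp (η : Fin n → E) (ι : A →ₐ[K] E) (M : Matrix (Fin n) (Fin n) A) (k : Fin n) :
    Matrix (Fin n) (Fin n) E :=
  ∑ i, jumpUp η i * Matrix.scalar (Fin n) (ι (M i k))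

theorem form_qExt (h : QExt (-qq) η) (hι : ∀ i y, Commute (η i) (ι y)) (hM : FRT M) :
    QExt (-qq⁻¹) (form η ι M) := by
  have hq := qq_ne_zero
  have hmul : ∀ k l, form η ι M k * form η ι M l =
      ∑ i, ∑ j, (η i * η j) * ι (M i k * M j l) := by
    intro k l
    rw [form, form, Finset.sum_mul_sum]
    refine Finset.sum_congr rfl fun i _ => Finset.sum_congr rfl fun j _ => ?_
    rw [map_mul, mul_assoc, mul_assoc, ← mul_assoc (ι _), ← (hι j (M i k)).eq, mul_assoc]
  have hcoef : ∀ i j, ca i j • (η j * η i) + cb i j • (η i * η j) = (-qq⁻¹) • (η i * η j) := by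
    intro i j
    rcases lt_trichotomy i j with hij | rfl | hij
    · rw [ca_of_ne hij.ne, cb_of_lt hij, h.comm hij]
      match_scalars
      field_simp
      ring
    · simp [h.sq]
    · rw [ca_of_ne hij.ne', cb_of_le hij.le, h.comm hij]
      match_scalars
      field_simp
      ring
  have key : ∀ k l, (-qq⁻¹) • (form η ι M k * form η ι M l) =
      ca k l • (form η ι M l * form η ι M k) + cb l k • (form η ι M k * form η ι M l) := by
    intro k l
    have hswap : ∀ k l, form η ι M k * form η ι M l = ∑ i, ∑ j, (η j * η i) * ι (M j k * M i l) :=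
      fun k l => by rw [hmul, Finset.sum_comm]
    rw [hswap l k]
    conv_rhs => rw [hswap k l]
    rw [hmul k l]
    simp only [Finset.smul_sum, ← Finset.sum_add_distrib]
    have e1 : ∀ i j, ca k l • (η j * η i * ι (M j l * M i k)) +
        cb l k • (η j * η i * ι (M j k * M i l)) =
        ca i j • (η j * η i * ι (M i k * M j l)) +
          cb j i • (η j * η i * ι (M j k * M i l)) := by
      intro i j
      have := congrArg (fun y => η j * η i * ι y) (hM i j k l)
      simpa only [map_add, map_smul, mul_add, mul_smul_comm] using this.symm
    simp only [e1, Finset.sum_add_distrib]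
    rw [Finset.sum_comm (f := fun i j => cb j i • (η j * η i * ι (M j k * M i l)))]
    simp only [← Finset.sum_add_distrib]
    refine Finset.sum_congr rfl fun i _ => Finset.sum_congr rfl fun j _ => ?_
    rw [← smul_mul_assoc (-qq⁻¹), ← hcoef, add_mul, smul_mul_assoc, smul_mul_assoc]
  constructor
  · intro k
    have h1 := key k k
    rw [ca_self, cb_self, zero_smul, add_zero, ← sub_eq_zero, ← sub_smul] at h1
    refine (smul_eq_zero.1 h1).resolve_left ?_
    intro h0
    have h2 : (RatFunc.X : RatFunc ℂ) ^ 2 = RatFunc.C (-1) := by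
      have h3 : qq ^ 2 = -1 := by
        field_simp at h0
        linear_combination -h0
      rw [map_neg, map_one]
      exact h3
    rw [← RatFunc.algebraMap_X, ← RatFunc.algebraMap_C, ← map_pow] at h2
    have h4 := congrArg Polynomial.natDegree (RatFunc.algebraMap_injective ℂ h2)
    rw [Polynomial.natDegree_X_pow, Polynomial.natDegree_C] at h4
    exact absurd h4 two_ne_zero
  · intro k l hkl
    have h1 := key k l
    rw [ca_of_ne hkl.ne, cb_of_le hkl.le, zero_smul, add_zero, one_smul] at h1
    exact h1.symm

theorem prod_form (h : QExt (-qq) η) (hι : ∀ i y, Commute (η i) (ι y)) :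
    (List.ofFn (form η ι M)).prod = (List.ofFn η).prod * ι (qdet M) :=
  h.prod_sum_eq ι hι M

theorem prod_jumpDown_form (h : QExt (-qq) η) (hι : ∀ i y, Commute (η i) (ι y)) (hM : FRT M) :
    (List.ofFn (jumpDown (form η ι M))).prod =
      qq • Matrix.scalar (Fin n) ((List.ofFn η).prod * ι (qdet M)) := by
  rw [prod_jumpDown (form_qExt h hι hM) (neg_ne_zero.2 (inv_ne_zero qq_ne_zero)),
    prod_form h hι]

theorem prod_formUp (h : QExt (-qq) η) (hι : ∀ i y, Commute (η i) (ι y)) :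
    (List.ofFn (formUp η ι M)).prod =
      qq • Matrix.scalar (Fin n) ((List.ofFn η).prod * ι (qdet M)) := by
  have h1 := (jumpUp_qExt h).prod_sum_eq ((Matrix.scalarAlgHom (Fin n) K).comp ι)
    (fun i y => by
      ext a b
      have := fun j => (hι j y).eq
      simp only [AlgHom.comp_apply, Matrix.scalarAlgHom_apply, Matrix.scalar_apply,
        Matrix.mul_diagonal, Matrix.diagonal_mul, jumpUp]
      split_ifs <;> simp [add_mul, mul_add, this]) M
  rw [prod_jumpUp h (neg_ne_zero.2 qq_ne_zero)] at h1
  rw [map_mul, ← smul_mul_assoc]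
  exact h1

theorem intertwine_prod {R : Type} [Ring R] {m : ℕ} {U V : Fin m → R} {x : R}
    (h : ∀ j, U j * x = x * V j) : (List.ofFn U).prod * x = x * (List.ofFn V).prod := by
  induction m with
  | zero => simp
  | succ m ih =>
    simp only [List.ofFn_succ, List.prod_cons]
    rw [mul_assoc, ih fun j => h j.succ, ← mul_assoc, h, mul_assoc]

/-- Extracting a quasi-commutation relation from an intertwining relation. -/
theorem quasiCommute_of_intertwine (hι : ∀ i y, Commute (η i) (ι y))
    (hcan : ∀ y z, (List.ofFn η).prod * ι y = (List.ofFn η).prod * ι z → y = z)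
    {U V : Fin n → Matrix (Fin n) (Fin n) E} {d : A} {u v : K}
    (h : ∀ j, U j * X.map ι = X.map ι * V j)
    (hU : (List.ofFn U).prod = u • Matrix.scalar (Fin n) ((List.ofFn η).prod * ι d))
    (hV : (List.ofFn V).prod = v • Matrix.scalar (Fin n) ((List.ofFn η).prod * ι d))
    (i j : Fin n) : u • (d * X i j) = v • (X i j * d) := by
  have h1 := intertwine_prod h
  rw [hU, hV] at h1
  have h2 := congrFun (congrFun h1 i) j
  simp only [smul_mul_assoc, mul_smul_comm, Matrix.smul_apply, Matrix.scalar_apply,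
    Matrix.diagonal_mul, Matrix.mul_diagonal, Matrix.map_apply] at h2
  have hc : Commute (List.ofFn η).prod (ι (X i j)) := by
    apply Commute.list_prod_left
    intro y hy
    obtain ⟨k, rfl⟩ := List.mem_ofFn.1 hy
    exact hι _ _
  rw [← mul_assoc, ← hc.eq, mul_assoc, mul_assoc] at h2
  apply hcan
  simpa [map_smul, map_mul, mul_smul_comm] using h2

theorem formUp_mul_apply (k a b : Fin n) (Y : Matrix (Fin n) (Fin n) A) :
    (formUp η ι M k * Y.map ι) a b =
      ∑ i, η i * ι (ca i a • (M i k * Y a b) + cb a i • (M a k * Y i b)) := by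
  have e : ∀ i m, jumpUp η i a m * ι (M i k) * ι (Y m b) =
      (if a = m then ca i a • (η i * ι (M i k * Y m b)) else 0) +
      (if a = i then cb i m • (η m * ι (M i k * Y m b)) else 0) := by
    intro i m
    rw [mul_assoc, ← map_mul, jumpUp]
    split_ifs <;> simp [add_mul]
  simp only [formUp, Finset.sum_mul, Matrix.sum_apply, Matrix.scalar_apply, Matrix.mul_apply,
    Matrix.map_apply, Matrix.diagonal_apply, mul_ite, mul_zero, Finset.sum_ite_eq',
    Finset.mem_univ, if_true, e, Finset.sum_add_distrib]
  rw [Finset.sum_comm]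
  simp [mul_add, Finset.sum_add_distrib]

theorem mul_formUp_apply (k a b : Fin n) (Y : Matrix (Fin n) (Fin n) A)
    (hι : ∀ i y, Commute (η i) (ι y)) :
    (Y.map ι * formUp η ι M k) a b =
      ∑ i, η i * ι (ca i b • (Y a b * M i k) +
        if i = b then ∑ m, cb m i • (Y a m * M m k) else 0) := by
  have e : ∀ m i, ι (Y a m) * (jumpUp η i m b * ι (M i k)) =
      (if m = b then ca i m • (η i * ι (Y a m * M i k)) else 0) +
      (if m = i then cb i b • (η b * ι (Y a m * M i k)) else 0) := by
    intro m i
    rw [jumpUp, map_mul, ← mul_assoc, ← mul_assoc, ← mul_assoc, (hι i _).eq, (hι b _).eq]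
    split_ifs <;> simp [add_mul, mul_add, mul_assoc]
  simp only [formUp, Finset.mul_sum, Matrix.sum_apply, Matrix.scalar_apply, Matrix.mul_apply,
    Matrix.map_apply, Matrix.diagonal_apply, mul_ite, mul_zero, Finset.sum_ite_eq',
    Finset.mem_univ, if_true, e, Finset.sum_add_distrib]
  simp only [map_add, mul_add, Finset.sum_add_distrib, Finset.sum_ite_eq', Finset.sum_ite_eq,
    Finset.mem_univ, if_true, map_smul, mul_smul_comm, apply_ite ι, map_sum, map_zero, mul_ite,
    mul_zero, Finset.mul_sum]
  congr 1
  rw [Finset.sum_comm]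
  simp

theorem jumpDown_form_mul_apply (k a b : Fin n) (Y : Matrix (Fin n) (Fin n) A) :
    (jumpDown (form η ι M) k * Y.map ι) a b =
      ∑ i, η i * ι (ca a k • (M i k * Y a b) +
        if a = k then ∑ m, cb m a • (M i m * Y m b) else 0) := by
  rw [jumpDown_mul]
  simp only [form, Matrix.map_apply, Finset.sum_mul, mul_assoc, ← map_mul, Finset.smul_sum,
    map_add, mul_add, Finset.sum_add_distrib, map_smul, mul_smul_comm]
  rw [ca_comm]
  congr 1
  split_ifs with h
  · subst h
    rw [Finset.sum_comm]
    simp [Finset.mul_sum]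
  · simp

theorem mul_jumpDown_form_apply (k a b : Fin n) (Y : Matrix (Fin n) (Fin n) A)
    (hι : ∀ i y, Commute (η i) (ι y)) :
    (Y.map ι * jumpDown (form η ι M) k) a b =
      ∑ i, η i * ι (ca k b • (Y a b * M i k) + cb b k • (Y a k * M i b)) := by
  rw [mul_jumpDown]
  simp only [form, Matrix.map_apply, Finset.mul_sum, ← mul_assoc, ← (hι _ _).eq, Finset.smul_sum,
    map_add, mul_add, Finset.sum_add_distrib, map_smul, mul_smul_comm, map_mul]

theorem scalar_form_mul_apply (k a b : Fin n) (Y : Matrix (Fin n) (Fin n) A) :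
    (Matrix.scalar (Fin n) (form η ι M k) * Y.map ι) a b = ∑ i, η i * ι (M i k * Y a b) := by
  simp only [form, Matrix.scalar_apply, Matrix.diagonal_mul, Matrix.map_apply, Finset.sum_mul,
    mul_assoc, map_mul]

theorem mul_scalar_form_apply (k a b : Fin n) (Y : Matrix (Fin n) (Fin n) A)
    (hι : ∀ i y, Commute (η i) (ι y)) :
    (Y.map ι * Matrix.scalar (Fin n) (form η ι M k)) a b = ∑ i, η i * ι (Y a b * M i k) := by
  simp only [form, Matrix.scalar_apply, Matrix.mul_diagonal, Matrix.map_apply, Finset.mul_sum,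
    ← mul_assoc, ← (hι _ _).eq, map_mul]

theorem prod_scalar_form (h : QExt (-qq) η) (hι : ∀ i y, Commute (η i) (ι y)) :
    (List.ofFn fun k => Matrix.scalar (Fin n) (form η ι M k)).prod =
      (1 : K) • Matrix.scalar (Fin n) ((List.ofFn η).prod * ι (qdet M)) := by
  rw [one_smul, ← prod_form h hι, map_list_prod, List.map_ofFn]
  rfl

end Normality

section QuasiCommutation

variable {n} {A : Type} [Ring A] [Algebra K A] {M X : Matrix (Fin n) (Fin n) A}

theorem qdet_mul_same (hM : FRT M) (i j : Fin n) : qq • (qdet M * M i j) = qq • (M i j * qdet M) := by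
  have hη := fock_qExt n A
  have hι := fock_commute n A
  refine quasiCommute_of_intertwine hι (fun _ _ => fock_prod_cancel n A) (fun k => ?_)
    (prod_formUp hη hι) (prod_jumpDown_form hη hι hM) i j
  ext1 a b
  rw [formUp_mul_apply, mul_jumpDown_form_apply _ _ _ _ hι]
  exact Finset.sum_congr rfl fun i _ => by rw [hM i a k b]

theorem qdet_mul_down
    (h : m1 n A M * m2 n A X = m2 n A X * ext n A (Rm21 n) * m1 n A M) (i j : Fin n) :
    (1 : K) • (qdet M * X i j) = qq • (X i j * qdet M) := by
  have hη := fock_qExt n A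
  have hι := fock_commute n A
  refine quasiCommute_of_intertwine hι (fun _ _ => fock_prod_cancel n A) (fun k => ?_)
    (prod_scalar_form hη hι) (prod_formUp hη hι) i j
  ext1 a b
  rw [scalar_form_mul_apply, mul_formUp_apply _ _ _ _ hι]
  refine Finset.sum_congr rfl fun i _ => ?_
  have := congrFun (congrFun h (i, a)) (k, b)
  rw [m1_mul_m2, m2_Rm21_m1] at this
  rw [this]

theorem qdet_mul_up (hM : FRT M)
    (h : m1 n A X * m2 n A M = m2 n A M * ext n A (Rm21 n) * m1 n A X) (i j : Fin n) :
    qq • (qdet M * X i j) = (1 : K) • (X i j * qdet M) := by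
  have hη := fock_qExt n A
  have hι := fock_commute n A
  refine quasiCommute_of_intertwine hι (fun _ _ => fock_prod_cancel n A) (fun k => ?_)
    (prod_jumpDown_form hη hι hM) (prod_scalar_form hη hι) i j
  ext1 a b
  rw [jumpDown_form_mul_apply, mul_scalar_form_apply _ _ _ _ hι]
  refine Finset.sum_congr rfl fun i _ => ?_
  have := congrFun (congrFun h (a, i)) (b, k)
  rw [m1_mul_m2, m2_Rm21_m1] at this
  rw [this]

theorem qdet_mul_opp (hM : FRT M)
    (h : m1 n A M * ext n A (Rm n) * m2 n A X = m2 n A X * ext n A (Rm21 n) * m1 n A M)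
    (i j : Fin n) : qq • (qdet M * X i j) = qq • (X i j * qdet M) := by
  have hη := fock_qExt n A
  have hι := fock_commute n A
  refine quasiCommute_of_intertwine hι (fun _ _ => fock_prod_cancel n A) (fun k => ?_)
    (prod_jumpDown_form hη hι hM) (prod_formUp hη hι) i j
  ext1 a b
  rw [jumpDown_form_mul_apply, mul_formUp_apply _ _ _ _ hι]
  refine Finset.sum_congr rfl fun i _ => ?_
  have := congrFun (congrFun h (i, a)) (k, b)
  rw [m1_Rm_m2, m2_Rm21_m1] at this
  simp only [] at this
  rw [this]

theorem qdet_mul_com (h : m1 n A M * m2 n A X = m2 n A X * m1 n A M) (i j : Fin n) :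
    (1 : K) • (qdet M * X i j) = (1 : K) • (X i j * qdet M) := by
  have hη := fock_qExt n A
  have hι := fock_commute n A
  refine quasiCommute_of_intertwine hι (fun _ _ => fock_prod_cancel n A) (fun k => ?_)
    (prod_scalar_form hη hι) (prod_scalar_form hη hι) i j
  ext1 a b
  rw [scalar_form_mul_apply, mul_scalar_form_apply _ _ _ _ hι]
  refine Finset.sum_congr rfl fun i _ => ?_
  have := congrFun (congrFun h (i, a)) (k, b)
  rw [m1_mul_m2, m2_mul_m1] at this
  rw [this]

end QuasiCommutation

section Normal

variable {ℓ n}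

/-- An element `s` of a ring is normal if `s R = R s`. -/
def IsNormalElt {R : Type} [Ring R] (s : R) : Prop :=
  (∀ y, ∃ z, s * y = z * s) ∧ ∀ y, ∃ z, y * s = s * z

theorem isNormalElt_of_adjoin {R : Type} [Ring R] [Algebra K R] {S : Set R}
    (hS : Algebra.adjoin K S = ⊤) {s : R}
    (h : ∀ x ∈ S, ∃ u : K, u ≠ 0 ∧ s * x = u • (x * s)) : IsNormalElt s := by
  constructor
  · intro y
    have hy : y ∈ Algebra.adjoin K S := hS ▸ Algebra.mem_top
    induction hy using Algebra.adjoin_induction with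
    | mem x hx =>
      obtain ⟨u, -, hu⟩ := h x hx
      exact ⟨u • x, by rw [hu, smul_mul_assoc]⟩
    | algebraMap r => exact ⟨algebraMap K R r, (Algebra.commutes r s).symm⟩
    | add x y _ _ hx hy =>
      obtain ⟨x', hx⟩ := hx
      obtain ⟨y', hy⟩ := hy
      exact ⟨x' + y', by rw [mul_add, add_mul, hx, hy]⟩
    | mul x y _ _ hx hy =>
      obtain ⟨x', hx⟩ := hx
      obtain ⟨y', hy⟩ := hy
      exact ⟨x' * y', by rw [← mul_assoc, hx, mul_assoc, hy, mul_assoc]⟩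
  · intro y
    have hy : y ∈ Algebra.adjoin K S := hS ▸ Algebra.mem_top
    induction hy using Algebra.adjoin_induction with
    | mem x hx =>
      obtain ⟨u, hu0, hu⟩ := h x hx
      exact ⟨u⁻¹ • x, by rw [mul_smul_comm, hu, smul_smul, inv_mul_cancel₀ hu0, one_smul]⟩
    | algebraMap r => exact ⟨algebraMap K R r, Algebra.commutes r s⟩
    | add x y _ _ hx hy =>
      obtain ⟨x', hx⟩ := hx
      obtain ⟨y', hy⟩ := hy
      exact ⟨x' + y', by rw [mul_add, add_mul, hx, hy]⟩
    | mul x y _ _ hx hy =>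
      obtain ⟨x', hx⟩ := hx
      obtain ⟨y', hy⟩ := hy
      exact ⟨x' * y', by rw [mul_assoc, hy, ← mul_assoc, hx, mul_assoc]⟩

theorem IsNormalElt.of_mem_closure {R : Type} [Ring R] {S : Set R}
    (hS : ∀ s ∈ S, IsNormalElt s) {s : R} (hs : s ∈ Submonoid.closure S) : IsNormalElt s := by
  induction hs using Submonoid.closure_induction with
  | mem x hx => exact hS x hx
  | one => exact ⟨fun y => ⟨y, by simp⟩, fun y => ⟨y, by simp⟩⟩
  | mul x y _ _ hx hy =>
    constructor
    · intro z
      obtain ⟨z', hz'⟩ := hy.1 z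
      obtain ⟨z'', hz''⟩ := hx.1 z'
      exact ⟨z'', by rw [mul_assoc, hz', ← mul_assoc, hz'', mul_assoc]⟩
    · intro z
      obtain ⟨z', hz'⟩ := hx.2 z
      obtain ⟨z'', hz''⟩ := hy.2 z'
      exact ⟨z'', by rw [← mul_assoc, hz', mul_assoc, hz'', mul_assoc]⟩

theorem swap_m1_Rm_m2 {A : Type} [Ring A] [Algebra K A] {X Y : Matrix (Fin n) (Fin n) A}
    (h : m1 n A X * ext n A (Rm n) * m2 n A Y = m2 n A Y * ext n A (Rm21 n) * m1 n A X) :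
    m1 n A Y * ext n A (Rm n) * m2 n A X = m2 n A X * ext n A (Rm21 n) * m1 n A Y := by
  ext p r
  have := congrFun (congrFun h p.swap) r.swap
  rw [m1_Rm_m2, m2_Rm21_m1] at this ⊢
  exact this.symm

theorem detq_mul_xg (hl : 2 ≤ ℓ) (a b : ZMod ℓ) (i j : Fin n) :
    ∃ u : K, u ≠ 0 ∧ detq ℓ n a * xg ℓ n b i j = u • (xg ℓ n b i j * detq ℓ n a) := by
  have hX := isRep_Xm (ℓ := ℓ) (n := n)
  have hfrt := (frt_iff _).1 (hX.frt a)
  have key : ∀ u v : K, u ≠ 0 → v ≠ 0 →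
      u • (qdet (Xm ℓ n a) * Xm ℓ n b i j) = v • (Xm ℓ n b i j * qdet (Xm ℓ n a)) →
      ∃ u : K, u ≠ 0 ∧ detq ℓ n a * xg ℓ n b i j = u • (xg ℓ n b i j * detq ℓ n a) := by
    intro u v hu hv h
    refine ⟨u⁻¹ * v, mul_ne_zero (inv_ne_zero hu) hv, ?_⟩
    rw [mul_smul]
    exact (eq_inv_smul_iff₀ hu).2 h
  by_cases hab : b = a
  · subst hab
    exact key _ _ qq_ne_zero qq_ne_zero (qdet_mul_same hfrt i j)
  rcases hl.eq_or_lt with h2 | h3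
  · obtain rfl := h2.symm
    have h01 := hX.adj2 rfl
    have h10 := swap_m1_Rm_m2 h01
    have hall : ∀ a b : ZMod 2, b ≠ a → (a = 1 + 1 ∧ b = 1) ∨ (a = 1 ∧ b = 1 + 1) := by decide
    rcases hall a b hab with ⟨rfl, rfl⟩ | ⟨rfl, rfl⟩
    · exact key _ _ qq_ne_zero qq_ne_zero (qdet_mul_opp hfrt h01 i j)
    · exact key _ _ qq_ne_zero qq_ne_zero (qdet_mul_opp hfrt h10 i j)
  · by_cases hdown : b = a - 1
    · subst hdown
      exact key _ _ one_ne_zero qq_ne_zero (qdet_mul_down (hX.adj h3 a) i j)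
    by_cases hup : b = a + 1
    · subst hup
      have := hX.adj h3 (a + 1)
      rw [add_sub_cancel_right] at this
      exact key _ _ qq_ne_zero one_ne_zero (qdet_mul_up hfrt this i j)
    · exact key _ _ one_ne_zero one_ne_zero (qdet_mul_com (hX.com a b ⟨hab, hup, hdown⟩) i j)

theorem isNormalElt_detq (hl : 2 ≤ ℓ) (a : ZMod ℓ) : IsNormalElt (detq ℓ n a) := by
  refine isNormalElt_of_adjoin adjoin_xg ?_
  rintro _ ⟨⟨b, i, j⟩, rfl⟩
  exact detq_mul_xg hl a b i j

end Normal

section Filtration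

variable {I : Type}

/-- Endomorphisms of the free vector space on `I`. -/
abbrev Op (I : Type) := Module.End K (I →₀ K)

/-- The basis vector attached to an element of `I`. -/
abbrev bv (ν : I) : I →₀ K := Finsupp.single ν 1

theorem Op.ext_bv {S T : Op I} (h : ∀ ν, S (bv ν) = T (bv ν)) : S = T :=
  Finsupp.lhom_ext' fun ν => LinearMap.ext_ring (h ν)

theorem Op.apply_eq_sum (T : Op I) (v : I →₀ K) : T v = v.sum fun ν c => c • T (bv ν) := by
  conv_lhs => rw [← Finsupp.sum_single v]
  rw [map_finsuppSum]
  refine Finsupp.sum_congr fun ν _ => ?_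
  rw [← map_smul, Finsupp.smul_single_one]

variable (wt : I → ℤ)

/-- The span of the basis vectors of weight at most `k`. -/
def wLe (k : ℤ) : Submodule K (I →₀ K) := Finsupp.supported K K {ρ | wt ρ ≤ k}

/-- `T` raises weights by at most `d`. -/
def DegLe (T : Op I) (d : ℤ) : Prop := ∀ ν, T (bv ν) ∈ wLe wt (wt ν + d)

variable {wt}

theorem wLe_mono {k l : ℤ} (h : k ≤ l) : wLe wt k ≤ wLe wt l :=
  Finsupp.supported_mono fun _ hρ => le_trans hρ h

theorem bv_mem_wLe {ν : I} {k : ℤ} (h : wt ν ≤ k) : bv ν ∈ wLe wt k :=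
  Finsupp.single_mem_supported K 1 h

theorem mem_wLe_apply {v : I →₀ K} {k : ℤ} (h : v ∈ wLe wt k) {ρ : I} (hρ : k < wt ρ) :
    v ρ = 0 := by
  by_contra hne
  exact absurd ((Finsupp.mem_supported K v).1 h (Finsupp.mem_support_iff.2 hne))
    (not_le.2 hρ)

theorem DegLe.map_wLe {T : Op I} {d k : ℤ} (h : DegLe wt T d) {v : I →₀ K} (hv : v ∈ wLe wt k) :
    T v ∈ wLe wt (k + d) := by
  rw [T.apply_eq_sum]
  refine Submodule.sum_mem _ fun ν hν => Submodule.smul_mem _ _ (wLe_mono ?_ (h ν))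
  have : wt ν ≤ k := (Finsupp.mem_supported K v).1 hv hν
  linarith

theorem DegLe.mono {T : Op I} {d e : ℤ} (h : DegLe wt T d) (hde : d ≤ e) : DegLe wt T e :=
  fun ν => wLe_mono (by linarith) (h ν)

theorem DegLe.mul {S T : Op I} {d e : ℤ} (hS : DegLe wt S d) (hT : DegLe wt T e) :
    DegLe wt (S * T) (d + e) := fun ν => by
  have := hS.map_wLe (hT ν)
  rwa [add_assoc, add_comm e d] at this

theorem DegLe.add {S T : Op I} {d : ℤ} (hS : DegLe wt S d) (hT : DegLe wt T d) :
    DegLe wt (S + T) d := fun ν => Submodule.add_mem _ (hS ν) (hT ν)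

theorem DegLe.zero (d : ℤ) : DegLe wt (0 : Op I) d := fun _ => Submodule.zero_mem _

theorem DegLe.sum {σ : Type} (s : Finset σ) {T : σ → Op I} {d : ℤ} (h : ∀ i ∈ s, DegLe wt (T i) d) :
    DegLe wt (∑ i ∈ s, T i) d := fun ν => by
  rw [LinearMap.sum_apply]
  exact Submodule.sum_mem _ fun i hi => h i hi ν

variable [AddCommMonoid I]

variable (wt) in
/-- `T` sends `bv ν` to a nonzero multiple of `bv (μ + ν)` plus terms of lower weight. -/
def Lead (T : Op I) (μ : I) : Prop :=
  ∀ ν, ∃ c : K, c ≠ 0 ∧ T (bv ν) - c • bv (μ + ν) ∈ wLe wt (wt μ + wt ν - 1)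

variable {μ μ' : I} {S T : Op I}

theorem Lead.degLe (hadd : ∀ μ ν, wt (μ + ν) = wt μ + wt ν) (h : Lead wt T μ) :
    DegLe wt T (wt μ) := fun ν => by
  obtain ⟨c, -, hc⟩ := h ν
  rw [← sub_add_cancel (T (bv ν)) (c • bv (μ + ν))]
  refine Submodule.add_mem _ (wLe_mono (by linarith) hc) (Submodule.smul_mem _ _ (bv_mem_wLe ?_))
  rw [hadd, add_comm]

theorem Lead.mul (hadd : ∀ μ ν, wt (μ + ν) = wt μ + wt ν) (hS : Lead wt S μ) (hT : Lead wt T μ') :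
    Lead wt (S * T) (μ + μ') := fun ν => by
  obtain ⟨c, hc0, hc⟩ := hT ν
  obtain ⟨d, hd0, hd⟩ := hS (μ' + ν)
  refine ⟨c * d, mul_ne_zero hc0 hd0, ?_⟩
  have e : (S * T) (bv ν) - (c * d) • bv (μ + μ' + ν) =
      S (T (bv ν) - c • bv (μ' + ν)) + c • (S (bv (μ' + ν)) - d • bv (μ + (μ' + ν))) := by
    rw [map_sub, map_smul, smul_sub, smul_smul, add_assoc]
    simp
  rw [e]
  refine Submodule.add_mem _ (wLe_mono ?_ ((hS.degLe hadd).map_wLe hc))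
    (Submodule.smul_mem _ _ (wLe_mono ?_ hd))
  · rw [hadd]; linarith
  · rw [hadd, hadd]; linarith

theorem Lead.one : Lead wt (1 : Op I) 0 := fun ν =>
  ⟨1, one_ne_zero, by simp⟩

theorem Lead.add (hS : Lead wt S μ) (hT : DegLe wt T (wt μ - 1)) : Lead wt (S + T) μ := fun ν => by
  obtain ⟨c, hc0, hc⟩ := hS ν
  refine ⟨c, hc0, ?_⟩
  have e : (S + T) (bv ν) - c • bv (μ + ν) = S (bv ν) - c • bv (μ + ν) + T (bv ν) := by
    rw [LinearMap.add_apply]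
    abel
  rw [e]
  exact Submodule.add_mem _ hc (wLe_mono (by linarith) (hT ν))

theorem Lead.list_prod (hadd : ∀ μ ν, wt (μ + ν) = wt μ + wt ν) {σ : Type} {T : σ → Op I}
    {μ : σ → I} (h : ∀ g, Lead wt (T g) (μ g)) (l : List σ) :
    Lead wt (l.map T).prod (l.map μ).sum := by
  induction l with
  | nil => exact Lead.one
  | cons a t ih =>
    rw [List.map_cons, List.map_cons, List.prod_cons, List.sum_cons]
    exact (h a).mul hadd ih

/-- Operators with distinct leading terms are independent, even after evaluation at a nonzero
vector. -/
theorem Lead.sum_apply_ne_zero [UniqueSums I] (hadd : ∀ μ ν, wt (μ + ν) = wt μ + wt ν)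
    {σ : Type} {s : Finset σ} (hs : s.Nonempty) {μ : σ → I} (hμ : Set.InjOn μ s) {T : σ → Op I}
    (hT : ∀ i ∈ s, Lead wt (T i) (μ i)) {f : σ → K} (hf : ∀ i ∈ s, f i ≠ 0) {v : I →₀ K}
    (hv : v ≠ 0) : (∑ i ∈ s, f i • T i) v ≠ 0 := by
  classical
  obtain ⟨i₁, hi₁, hmax⟩ := s.exists_max_image (fun i => wt (μ i)) hs
  obtain ⟨ν₁, hν₁, hmax'⟩ := v.support.exists_max_image wt (Finsupp.support_nonempty_iff.2 hv)
  obtain ⟨μ₀, hμ₀, ν₀, hν₀, huniq⟩ := UniqueSums.uniqueAdd_of_nonempty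
    (A := (s.filter fun i => wt (μ i) = wt (μ i₁)).image μ)
    (B := v.support.filter fun ν => wt ν = wt ν₁)
    ⟨μ i₁, by simpa using ⟨i₁, ⟨hi₁, rfl⟩, rfl⟩⟩ ⟨ν₁, by simpa using hν₁⟩
  obtain ⟨i₀, hi₀, rfl⟩ := Finset.mem_image.1 hμ₀
  rw [Finset.mem_filter] at hi₀ hν₀
  have hterm : ∀ i ∈ s, ∀ ν ∈ v.support, ¬ (i = i₀ ∧ ν = ν₀) → T i (bv ν) (μ i₀ + ν₀) = 0 := by
    intro i hi ν hν hne
    obtain ⟨c, -, hc⟩ := hT i hi ν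
    have hw : wt (μ i₀ + ν₀) = wt (μ i₁) + wt ν₁ := by rw [hadd, hi₀.2, hν₀.2]
    have h1 := hmax i hi
    have h2 := hmax' ν hν
    have h3 := mem_wLe_apply hc (ρ := μ i₀ + ν₀) (by rw [hw]; linarith)
    rw [Finsupp.sub_apply, sub_eq_zero] at h3
    rw [h3, Finsupp.smul_apply, Finsupp.single_apply, if_neg, smul_zero]
    intro heq
    apply hne
    rw [← heq, hadd] at hw
    have hi' : wt (μ i) = wt (μ i₁) := by linarith
    have hν' : wt ν = wt ν₁ := by linarith
    obtain ⟨e1, e2⟩ := huniq (Finset.mem_image_of_mem μ (Finset.mem_filter.2 ⟨hi, hi'⟩))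
      (Finset.mem_filter.2 ⟨hν, hν'⟩) heq
    exact ⟨hμ hi hi₀.1 e1, e2⟩
  have hcoef : (∑ i ∈ s, f i • T i) v (μ i₀ + ν₀) =
      f i₀ * (v ν₀ * T i₀ (bv ν₀) (μ i₀ + ν₀)) := by
    rw [LinearMap.sum_apply, Finsupp.finsetSum_apply, Finset.sum_eq_single_of_mem i₀ hi₀.1]
    · rw [LinearMap.smul_apply, Finsupp.smul_apply, smul_eq_mul, (T i₀).apply_eq_sum v,
        Finsupp.sum, Finsupp.finsetSum_apply, Finset.sum_eq_single_of_mem ν₀ hν₀.1]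
      · rfl
      · intro ν hν hne
        rw [Finsupp.smul_apply, hterm i₀ hi₀.1 ν hν (fun h => hne h.2), smul_zero]
    · intro i hi hne
      rw [LinearMap.smul_apply, Finsupp.smul_apply, (T i).apply_eq_sum v, Finsupp.sum,
        Finsupp.finsetSum_apply, Finset.sum_eq_zero, smul_zero]
      intro ν hν
      rw [Finsupp.smul_apply, hterm i hi ν hν (fun h => hne h.1), smul_zero]
  intro h0
  rw [h0, Finsupp.zero_apply] at hcoef
  obtain ⟨c, hc0, hc⟩ := hT i₀ hi₀.1 ν₀
  have h3 := mem_wLe_apply hc (ρ := μ i₀ + ν₀) (by rw [hadd]; linarith)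
  rw [Finsupp.sub_apply, sub_eq_zero] at h3
  rw [h3] at hcoef
  refine mul_ne_zero (hf i₀ hi₀.1) (mul_ne_zero (Finsupp.mem_support_iff.1 hν₀.1) ?_) hcoef.symm
  simpa using hc0

/-- A spanned algebra acting through leading terms has no zero divisors. -/
theorem noZeroDivisors_of_lead [UniqueSums I] (hadd : ∀ μ ν, wt (μ + ν) = wt μ + wt ν)
    {R J : Type} [Ring R] [Algebra K R] (φ : R →ₐ[K] Op I) {w : J → R}
    (hw : Submodule.span K (Set.range w) = ⊤) {μ : J → I} (hμ : Function.Injective μ)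
    (hφ : ∀ j, Lead wt (φ (w j)) (μ j)) : NoZeroDivisors R := by
  have key : ∀ x : R, x ≠ 0 → ∀ v : I →₀ K, v ≠ 0 → φ x v ≠ 0 := by
    intro x hx v hv
    have hmem : x ∈ Submodule.span K (Set.range w) := hw ▸ Submodule.mem_top
    obtain ⟨f, rfl⟩ := (Finsupp.mem_span_range_iff_exists_finsupp).1 hmem
    have hf : f ≠ 0 := by
      rintro rfl
      simp at hx
    rw [Finsupp.sum, map_sum]
    simp only [map_smul]
    exact Lead.sum_apply_ne_zero hadd (Finsupp.support_nonempty_iff.2 hf)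
      hμ.injOn (fun i _ => hφ i) (fun i hi => Finsupp.mem_support_iff.1 hi) hv
  constructor
  intro x y hxy
  by_contra! h
  have h1 := key y h.2 (bv 0) (by simp)
  have h2 := key x h.1 _ h1
  apply h2
  rw [← Module.End.mul_apply, ← map_mul, hxy, map_zero, LinearMap.zero_apply]

end Filtration

section Spanning

variable {R σ : Type} [Ring R] [Algebra K R]

/-- The span of the words of weight less than `N`. -/
def lowWords (x : σ → R) (w : σ → ℕ) (N : ℕ) : Submodule K R :=
  Submodule.span K {y | ∃ L : List σ, (L.map w).sum < N ∧ (L.map x).prod = y}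

variable {x : σ → R} {w : σ → ℕ}

theorem mul_mem_lowWords {N : ℕ} {y : R} (hy : y ∈ lowWords x w N) (L L' : List σ) :
    (L.map x).prod * y * (L'.map x).prod ∈
      lowWords x w ((L.map w).sum + N + (L'.map w).sum) := by
  induction hy using Submodule.span_induction with
  | mem y hy =>
    obtain ⟨M, hM, rfl⟩ := hy
    refine Submodule.subset_span ⟨L ++ M ++ L', ?_, ?_⟩
    · simp only [List.map_append, List.sum_append]
      omega
    · simp only [List.map_append, List.prod_append]
  | zero => simp
  | add y z _ _ hy hz =>
    rw [mul_add, add_mul]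
    exact Submodule.add_mem _ hy hz
  | smul c y _ hy =>
    rw [mul_smul_comm, smul_mul_assoc]
    exact Submodule.smul_mem _ c hy

/-- Generators commute up to scalars and terms of lower weight. -/
def WordComm (x : σ → R) (w : σ → ℕ) (g h : σ) : Prop :=
  ∃ c : K, c ≠ 0 ∧ x g * x h - c • (x h * x g) ∈ lowWords x w (w g + w h)

theorem WordComm.symm {g h : σ} (hgh : WordComm x w g h) : WordComm x w h g := by
  obtain ⟨c, hc0, hc⟩ := hgh
  refine ⟨c⁻¹, inv_ne_zero hc0, ?_⟩
  have e : x h * x g - c⁻¹ • (x g * x h) = (-c⁻¹) • (x g * x h - c • (x h * x g)) := by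
    match_scalars <;> field_simp
  rw [e, add_comm (w h)]
  exact Submodule.smul_mem _ _ hc

theorem exists_perm_lowWords (hrel : ∀ g h, WordComm x w g h) {L L' : List σ} (hL : L.Perm L') :
    ∃ c : K, (L.map x).prod - c • (L'.map x).prod ∈ lowWords x w (L.map w).sum := by
  induction hL with
  | nil => exact ⟨1, by simp⟩
  | cons a h ih =>
    obtain ⟨c, hc⟩ := ih
    refine ⟨c, ?_⟩
    have := mul_mem_lowWords hc [a] []
    simpa [mul_sub] using this
  | swap a b l =>
    obtain ⟨c, -, hc⟩ := hrel b a
    refine ⟨c, ?_⟩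
    have := mul_mem_lowWords hc [] l
    simpa [sub_mul, mul_assoc, add_assoc] using this
  | trans h1 h2 ih1 ih2 =>
    obtain ⟨c, hc⟩ := ih1
    obtain ⟨d, hd⟩ := ih2
    refine ⟨c * d, ?_⟩
    rw [← (h1.map w).sum_eq] at hd
    have := Submodule.add_mem _ hc (Submodule.smul_mem _ c hd)
    rwa [smul_sub, smul_smul, sub_add_sub_cancel] at this

theorem span_words_eq_top (hS : Algebra.adjoin K (Set.range x) = ⊤)
    (hrel : ∀ g h, WordComm x w g h) :
    Submodule.span K (Set.range fun m : Multiset σ => (m.toList.map x).prod) = ⊤ := by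
  have hword : ∀ N : ℕ, ∀ L : List σ, (L.map w).sum < N →
      (L.map x).prod ∈ Submodule.span K (Set.range fun m : Multiset σ => (m.toList.map x).prod) := by
    intro N
    induction N with
    | zero => exact fun L hL => absurd hL (Nat.not_lt_zero _)
    | succ N ih =>
      intro L hL
      have hperm : L.Perm (L : Multiset σ).toList :=
        (Multiset.coe_eq_coe.1 (Multiset.coe_toList (L : Multiset σ))).symm
      obtain ⟨c, hc⟩ := exists_perm_lowWords hrel hperm
      rw [← sub_add_cancel (L.map x).prod]
      refine Submodule.add_mem _ (Submodule.span_le.2 ?_ hc)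
        (Submodule.smul_mem _ c (Submodule.subset_span ⟨_, rfl⟩))
      rintro _ ⟨M, hM, rfl⟩
      exact ih M (by omega)
  rw [eq_top_iff, ← Algebra.top_toSubmodule, ← hS, Algebra.adjoin_eq_span, Submodule.span_le]
  intro y hy
  obtain ⟨l, hl, rfl⟩ := Submonoid.exists_list_of_mem_closure hy
  obtain ⟨L, rfl⟩ : ∃ L : List σ, L.map x = l := by
    have h : l ∈ {l : List R | ∀ y ∈ l, y ∈ Set.range x} := hl
    rwa [← Set.range_list_map] at h
  exact hword _ L (Nat.lt_succ_self _)

end Spanning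

section Commutation

variable {ℓ n} {A : Type} [Ring A] [Algebra K A] {X : ZMod ℓ → Matrix (Fin n) (Fin n) A}

/-- The weight of the generator `x_ik` used for the straightening of words. -/
def genWt (g : ZMod ℓ × Fin n × Fin n) : ℕ := n * g.2.1 + (n - g.2.1) * g.2.2

/-- The generators read off a family of matrices. -/
def entry (X : ZMod ℓ → Matrix (Fin n) (Fin n) A) (g : ZMod ℓ × Fin n × Fin n) : A :=
  X g.1 g.2.1 g.2.2

theorem genWt_cast (a : ZMod ℓ) (i k : Fin n) :
    (genWt (a, i, k) : ℤ) = n * i + (n - i) * k := by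
  simp only [genWt]
  push_cast [Nat.cast_sub i.2.le]
  rfl

theorem entry_mul_mem_lowWords {a b : ZMod ℓ} {i j k l : Fin n} {N : ℕ}
    (h : genWt (a, i, k) + genWt (b, j, l) < N) :
    X a i k * X b j l ∈ lowWords (entry X) genWt N :=
  Submodule.subset_span ⟨[(a, i, k), (b, j, l)], by simpa using h, by simp [entry]⟩

theorem qq_sub_cb_ne_zero (i j : Fin n) : qq - cb i j ≠ 0 := by
  unfold cb; split_ifs
  · simpa using qq_ne_zero
  · simpa using qq_ne_zero

theorem genWt_swap_lt {a : ZMod ℓ} {i j k l : Fin n} (h : (i < j ∧ l < k) ∨ (j < i ∧ k < l)) :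
    genWt (a, j, k) + genWt (a, i, l) < genWt (a, i, k) + genWt (a, j, l) := by
  zify
  simp only [genWt_cast]
  have h1 : 0 < ((j : ℤ) - i) * ((k : ℤ) - l) := by
    rcases h with ⟨h1, h2⟩ | ⟨h1, h2⟩
    · refine mul_pos ?_ ?_ <;> simpa
    · refine mul_pos_of_neg_of_neg ?_ ?_ <;> simpa
  nlinarith

theorem FRT.wordComm {a : ZMod ℓ} (hX : FRT (X a)) (i j k l : Fin n) :
    WordComm (entry X) genWt (a, i, k) (a, j, l) := by
  have h := hX i j k l
  rcases eq_or_ne i j with rfl | hij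
  · rcases eq_or_ne k l with rfl | hkl
    · exact ⟨1, one_ne_zero, by simp⟩
    · rw [ca_self, ca_of_ne hkl, cb_self] at h
      refine ⟨(qq - cb l k)⁻¹, inv_ne_zero (qq_sub_cb_ne_zero _ _), ?_⟩
      have h' : X a i l * X a i k = (qq - cb l k) • (X a i k * X a i l) := by
        rw [sub_smul, eq_sub_iff_add_eq]
        simpa using h.symm
      simp [entry, h', smul_smul, inv_mul_cancel₀ (qq_sub_cb_ne_zero l k)]
  · rcases eq_or_ne k l with rfl | hkl
    · rw [ca_self, ca_of_ne hij, cb_self] at h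
      refine ⟨qq - cb j i, qq_sub_cb_ne_zero _ _, ?_⟩
      have h' : X a i k * X a j k = (qq - cb j i) • (X a j k * X a i k) := by
        rw [sub_smul, eq_sub_iff_add_eq]
        simpa using h
      simp [entry, h']
    · rw [ca_of_ne hij, ca_of_ne hkl, one_smul, one_smul] at h
      have h' : X a i k * X a j l - X a j l * X a i k = (cb l k - cb j i) • (X a j k * X a i l) := by
        rw [sub_smul, sub_eq_sub_iff_add_eq_add, h, add_comm]
      refine ⟨1, one_ne_zero, ?_⟩
      rw [one_smul]
      simp only [entry]
      rw [h']
      rcases hij.lt_or_gt with hij | hij <;> rcases hkl.lt_or_gt with hkl | hkl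
      · simp [cb_of_le hij.le, cb_of_le hkl.le]
      · exact Submodule.smul_mem _ _
          (entry_mul_mem_lowWords (genWt_swap_lt (Or.inl ⟨hij, hkl⟩)))
      · exact Submodule.smul_mem _ _
          (entry_mul_mem_lowWords (genWt_swap_lt (Or.inr ⟨hij, hkl⟩)))
      · simp [cb_of_lt hij, cb_of_lt hkl]

theorem genWt_adj_lt {a b : ZMod ℓ} {i j k m : Fin n} (h : m < i) :
    genWt (b, j, m) + genWt (a, m, k) < genWt (a, i, k) + genWt (b, j, i) := by
  zify
  simp only [genWt_cast]
  have h1 : (m : ℤ) < i := by simpa using h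
  have h2 : (j : ℤ) < n := by simp
  have h3 : (k : ℤ) < n := by simp
  nlinarith [mul_pos (sub_pos.2 h1) (sub_pos.2 h2), mul_pos (sub_pos.2 h1) (sub_pos.2 h3)]

theorem sum_cb_mem_lowWords {a b : ZMod ℓ} {i j k : Fin n} :
    ∑ m, cb m i • (X b j m * X a m k) ∈
      lowWords (entry X) genWt (genWt (a, i, k) + genWt (b, j, i)) := by
  refine Submodule.sum_mem _ fun m _ => ?_
  rcases lt_or_ge m i with hm | hm
  · exact Submodule.smul_mem _ _ (entry_mul_mem_lowWords (genWt_adj_lt hm))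
  · simp [cb_of_le hm]

theorem IsRep.wordComm_adj (hX : IsRep X) (h : 3 ≤ ℓ) (a : ZMod ℓ) (i j k l : Fin n) :
    WordComm (entry X) genWt (a, i, k) (a - 1, j, l) := by
  have e := congrFun (congrFun (hX.adj h a) (i, j)) (k, l)
  rw [m1_mul_m2, m2_Rm21_m1] at e
  refine ⟨ca i l, ca_ne_zero _ _, ?_⟩
  simp only [entry] at e ⊢
  rw [e, add_sub_cancel_left]
  split_ifs with hil
  · subst hil
    exact sum_cb_mem_lowWords
  · exact Submodule.zero_mem _

theorem IsRep.wordComm_adj_two (hX : IsRep X) (h : ℓ = 2) (i j k l : Fin n) :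
    WordComm (entry X) genWt (1 + 1, i, k) (1, j, l) := by
  have e := congrFun (congrFun (hX.adj2 h) (i, j)) (k, l)
  rw [m1_Rm_m2, m2_Rm21_m1, ← eq_sub_iff_add_eq] at e
  refine ⟨(ca j k)⁻¹ * ca i l, mul_ne_zero (inv_ne_zero (ca_ne_zero _ _)) (ca_ne_zero _ _), ?_⟩
  simp only [entry] at e ⊢
  have e' := congrArg ((ca j k)⁻¹ • ·) e
  simp only [smul_smul, inv_mul_cancel₀ (ca_ne_zero j k), one_smul] at e'
  rw [e', smul_sub, smul_add, smul_smul, add_sub_assoc, add_sub_cancel_left]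
  refine Submodule.sub_mem _ (Submodule.smul_mem _ _ ?_) (Submodule.smul_mem _ _ ?_)
  · split_ifs with hil
    · subst hil
      exact sum_cb_mem_lowWords
    · exact Submodule.zero_mem _
  · split_ifs with hjk
    · subst hjk
      rw [add_comm]
      exact sum_cb_mem_lowWords
    · exact Submodule.zero_mem _

theorem IsRep.wordComm (hl : 2 ≤ ℓ) (hX : IsRep X) (g h : ZMod ℓ × Fin n × Fin n) :
    WordComm (entry X) genWt g h := by
  obtain ⟨a, i, k⟩ := g
  obtain ⟨b, j, l⟩ := h
  rcases eq_or_ne b a with rfl | hab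
  · exact FRT.wordComm ((frt_iff _).1 (hX.frt b)) i j k l
  rcases hl.eq_or_lt with rfl | hl
  · have h2 : (a = 1 + 1 ∧ b = 1) ∨ (a = 1 ∧ b = 1 + 1) := by
      revert a b; decide
    rcases h2 with ⟨rfl, rfl⟩ | ⟨rfl, rfl⟩
    · exact hX.wordComm_adj_two rfl i j k l
    · exact (hX.wordComm_adj_two rfl j i l k).symm
  · by_cases h1 : b = a - 1
    · subst h1
      exact hX.wordComm_adj hl a i j k l
    by_cases h2 : b = a + 1
    · subst h2
      have := (hX.wordComm_adj hl (a + 1) j i l k).symm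
      rwa [add_sub_cancel_right] at this
    · refine ⟨1, one_ne_zero, ?_⟩
      have e := congrFun (congrFun (hX.com a b ⟨hab, h2, h1⟩) (i, j)) (k, l)
      rw [m1_mul_m2, m2_mul_m1] at e
      simp only [entry] at e ⊢
      simp [e]

/-- The ordered monomials span `O_ℓ`. -/
theorem span_ordered_words (hl : 2 ≤ ℓ) :
    Submodule.span K (Set.range fun m : Multiset (ZMod ℓ × Fin n × Fin n) =>
      (m.toList.map (entry (Xm ℓ n))).prod) = ⊤ :=
  span_words_eq_top adjoin_xg (isRep_Xm.wordComm hl)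

end Commutation

section ThreeLegs

variable {n} {A : Type} [Ring A] [Algebra K A]

/-- The Yang–Baxter equation, for the operators `ca x y + cb x y (x ↔ y)` on functions of three
variables. -/
theorem yang_baxter {M : Type} [AddCommGroup M] [Module K M] (V : Fin n → Fin n → Fin n → M)
    (x y z : Fin n) :
    ca x y • (ca x z • (ca y z • V x y z + cb y z • V x z y) +
        cb x z • (ca y x • V z y x + cb y x • V z x y)) +
      cb x y • (ca y z • (ca x z • V y x z + cb x z • V y z x) +
        cb y z • (ca x y • V z x y + cb x y • V z y x)) =
    ca y z • (ca x z • (ca x y • V x y z + cb x y • V y x z) +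
        cb x z • (ca z y • V z y x + cb z y • V y z x)) +
      cb y z • (ca x y • (ca x z • V x z y + cb x z • V z x y) +
        cb x y • (ca y z • V y z x + cb y z • V z y x)) := by
  have hq := qq_ne_zero
  rcases lt_trichotomy x y with h1 | h1 | h1 <;> rcases lt_trichotomy y z with h2 | h2 | h2 <;>
    rcases lt_trichotomy x z with h3 | h3 | h3
  all_goals first | (exfalso; order) | skip
  all_goals try subst h1
  all_goals try subst h2
  all_goals
    simp only [ca, cb, if_true, lt_irrefl, if_false, *, ne_of_lt, ne_of_gt, not_lt_of_gt] <;>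
    match_scalars <;> field_simp <;> ring

/-- Index type for `M_n ⊗ M_n ⊗ M_n`. -/
abbrev Idx3 (n : ℕ) := Idx n × Fin n

/-- An `R`-matrix acting on two of the three legs, read off by `u` and `v` and exchanged by `s`. -/
def legR (A : Type) [Ring A] [Algebra K A] (u v : Idx3 n → Fin n) (s : Idx3 n → Idx3 n) :
    Matrix (Idx3 n) (Idx3 n) A := fun p r =>
  (if p = r then algebraMap K A (ca (u p) (v p)) else 0) +
    if s p = r then algebraMap K A (cb (u p) (v p)) else 0

theorem legR_mul {u v : Idx3 n → Fin n} {s : Idx3 n → Idx3 n} {J : Type}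
    (M : Matrix (Idx3 n) J A) (p : Idx3 n) (r : J) :
    (legR A u v s * M) p r = ca (u p) (v p) • M p r + cb (u p) (v p) • M (s p) r := by
  simp [Matrix.mul_apply, legR, add_mul, Finset.sum_add_distrib, ← Algebra.smul_def]

theorem mul_legR {u v : Idx3 n → Fin n} {s : Idx3 n → Idx3 n} (hs : ∀ p, s (s p) = p) {J : Type}
    (M : Matrix J (Idx3 n) A) (p : J) (r : Idx3 n) :
    (M * legR A u v s) p r = ca (u r) (v r) • M p r + cb (u (s r)) (v (s r)) • M p (s r) := by
  have hs' : ∀ p r, s p = r ↔ p = s r :=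
    fun p r => ⟨fun h => by rw [← h, hs], fun h => by rw [h, hs]⟩
  simp [Matrix.mul_apply, legR, mul_add, Finset.sum_add_distrib, hs', ← Algebra.commutes,
    ← Algebra.smul_def]

def sw12 (p : Idx3 n) : Idx3 n := ((p.1.2, p.1.1), p.2)
def sw13 (p : Idx3 n) : Idx3 n := ((p.2, p.1.2), p.1.1)
def sw23 (p : Idx3 n) : Idx3 n := ((p.1.1, p.2), p.1.2)

abbrev R12 (n : ℕ) (A : Type) [Ring A] [Algebra K A] : Matrix (Idx3 n) (Idx3 n) A :=
  legR A (fun p => p.1.1) (fun p => p.1.2) sw12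
abbrev R21 (n : ℕ) (A : Type) [Ring A] [Algebra K A] : Matrix (Idx3 n) (Idx3 n) A :=
  legR A (fun p => p.1.2) (fun p => p.1.1) sw12
abbrev R13 (n : ℕ) (A : Type) [Ring A] [Algebra K A] : Matrix (Idx3 n) (Idx3 n) A :=
  legR A (fun p => p.1.1) (fun p => p.2) sw13
abbrev R31 (n : ℕ) (A : Type) [Ring A] [Algebra K A] : Matrix (Idx3 n) (Idx3 n) A :=
  legR A (fun p => p.2) (fun p => p.1.1) sw13
abbrev R23 (n : ℕ) (A : Type) [Ring A] [Algebra K A] : Matrix (Idx3 n) (Idx3 n) A :=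
  legR A (fun p => p.1.2) (fun p => p.2) sw23
abbrev R32 (n : ℕ) (A : Type) [Ring A] [Algebra K A] : Matrix (Idx3 n) (Idx3 n) A :=
  legR A (fun p => p.2) (fun p => p.1.2) sw23

theorem R12_R13_R23 : R12 n A * (R13 n A * R23 n A) = R23 n A * (R13 n A * R12 n A) := by
  have h (M : Matrix (Idx3 n) (Idx3 n) A) :
      R12 n A * (R13 n A * (R23 n A * M)) = R23 n A * (R13 n A * (R12 n A * M)) := by
    ext ⟨⟨x, y⟩, z⟩ r
    simp only [legR_mul, sw12, sw13, sw23]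
    exact yang_baxter (fun x y z => M ((x, y), z) r) x y z
  simpa using h 1

theorem R32_R31_R21 : R32 n A * (R31 n A * R21 n A) = R21 n A * (R31 n A * R32 n A) := by
  have h (M : Matrix (Idx3 n) (Idx3 n) A) :
      R32 n A * (R31 n A * (R21 n A * M)) = R21 n A * (R31 n A * (R32 n A * M)) := by
    ext ⟨⟨z, y⟩, x⟩ r
    simp only [legR_mul, sw12, sw13, sw23]
    exact yang_baxter (fun x y z => M ((z, y), x) r) x y z
  simpa using h 1

theorem R23_R21_R31 : R23 n A * (R21 n A * R31 n A) = R31 n A * (R21 n A * R23 n A) := by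
  have h (M : Matrix (Idx3 n) (Idx3 n) A) :
      R23 n A * (R21 n A * (R31 n A * M)) = R31 n A * (R21 n A * (R23 n A * M)) := by
    ext ⟨⟨z, x⟩, y⟩ r
    simp only [legR_mul, sw12, sw13, sw23]
    exact yang_baxter (fun x y z => M ((z, x), y) r) x y z
  simpa using h 1

/-- `M ⊗ 1` with the identity on the third leg. -/
def lift3 (M : Matrix (Idx n) (Idx n) A) : Matrix (Idx3 n) (Idx3 n) A :=
  Matrix.blockDiagonal fun _ => M

theorem lift3_apply (M : Matrix (Idx n) (Idx n) A) (p r : Idx3 n) :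
    lift3 M p r = if p.2 = r.2 then M p.1 r.1 else 0 := Matrix.blockDiagonal_apply ..

theorem lift3_mul (M N : Matrix (Idx n) (Idx n) A) : lift3 (M * N) = lift3 M * lift3 N :=
  Matrix.blockDiagonal_mul _ _

theorem lift3_sub (M N : Matrix (Idx n) (Idx n) A) : lift3 (M - N) = lift3 M - lift3 N :=
  Matrix.blockDiagonal_sub _ _

theorem lift3_ext_Rm : lift3 (ext n A (Rm n)) = R12 n A := by
  ext ⟨⟨i, j⟩, p⟩ ⟨⟨k, l⟩, m⟩
  simp only [lift3_apply, ext, Matrix.map_apply, Rm_apply, legR, sw12, Prod.mk.injEq,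
    Prod.swap_prod_mk]
  by_cases hp : p = m
  · simp [hp, apply_ite (algebraMap K A), and_comm]
  · simp [hp]

theorem lift3_ext_Rm21 : lift3 (ext n A (Rm21 n)) = R21 n A := by
  ext ⟨⟨i, j⟩, p⟩ ⟨⟨k, l⟩, m⟩
  simp only [lift3_apply, ext, Matrix.map_apply, Rm21_apply, legR, sw12, Prod.mk.injEq,
    Prod.swap_prod_mk]
  by_cases hp : p = m
  · simp [hp, apply_ite (algebraMap K A), and_comm, ca_comm j i]
  · simp [hp]

theorem R13_comm_m2 (X : Matrix (Fin n) (Fin n) A) :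
    R13 n A * lift3 (m2 n A X) = lift3 (m2 n A X) * R13 n A := by
  ext ⟨⟨i, j⟩, p⟩ ⟨⟨k, l⟩, m⟩
  rw [legR_mul, mul_legR (fun _ => rfl)]
  simp only [lift3_apply, m2_apply, sw13]
  by_cases h1 : i = k <;> by_cases h2 : p = m <;> by_cases h3 : p = k <;> by_cases h4 : i = m <;>
    simp_all

theorem R31_comm_m2 (X : Matrix (Fin n) (Fin n) A) :
    R31 n A * lift3 (m2 n A X) = lift3 (m2 n A X) * R31 n A := by
  ext ⟨⟨i, j⟩, p⟩ ⟨⟨k, l⟩, m⟩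
  rw [legR_mul, mul_legR (fun _ => rfl)]
  simp only [lift3_apply, m2_apply, sw13]
  by_cases h1 : i = k <;> by_cases h2 : p = m <;> by_cases h3 : p = k <;> by_cases h4 : i = m <;>
    simp_all

theorem R23_comm_m1 (X : Matrix (Fin n) (Fin n) A) :
    R23 n A * lift3 (m1 n A X) = lift3 (m1 n A X) * R23 n A := by
  ext ⟨⟨i, j⟩, p⟩ ⟨⟨k, l⟩, m⟩
  rw [legR_mul, mul_legR (fun _ => rfl)]
  simp only [lift3_apply, m1_apply, sw23]
  by_cases h1 : j = l <;> by_cases h2 : p = m <;> by_cases h3 : p = l <;> by_cases h4 : j = m <;>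
    simp_all

theorem R32_comm_m1 (X : Matrix (Fin n) (Fin n) A) :
    R32 n A * lift3 (m1 n A X) = lift3 (m1 n A X) * R32 n A := by
  ext ⟨⟨i, j⟩, p⟩ ⟨⟨k, l⟩, m⟩
  rw [legR_mul, mul_legR (fun _ => rfl)]
  simp only [lift3_apply, m1_apply, sw23]
  by_cases h1 : j = l <;> by_cases h2 : p = m <;> by_cases h3 : p = l <;> by_cases h4 : j = m <;>
    simp_all

/-- A row vector placed on the third leg. -/
def row3 (z : Fin n → A) : Matrix (Idx n) (Idx3 n) A := fun p r => if p = r.1 then z r.2 else 0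

theorem mul_row3_apply (z : Fin n → A) (M : Matrix (Idx n) (Idx n) A) (p : Idx n) (r : Idx3 n) :
    (M * row3 z) p r = M p r.1 * z r.2 := by
  simp [Matrix.mul_apply, row3]

theorem row3_mul_apply {J : Type} (z : Fin n → A) (M : Matrix (Idx3 n) J A) (p : Idx n) (r : J) :
    (row3 z * M) p r = ∑ m, z m * M (p, m) r := by
  rw [Matrix.mul_apply, Fintype.sum_prod_type, Finset.sum_eq_single p]
  · simp [row3]
  · intro q _ hq
    simp [row3, Ne.symm hq]
  · simp

theorem row3_mul_lift3_apply (z : Fin n → A) (M : Matrix (Idx n) (Idx n) A) (p : Idx n)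
    (r : Idx3 n) : (row3 z * lift3 M) p r = z r.2 * M p r.1 := by
  simp [row3_mul_apply, lift3_apply]

theorem ext_mul_row3 (z : Fin n → A) (M : Matrix (Idx n) (Idx n) K) :
    ext n A M * row3 z = row3 z * lift3 (ext n A M) := by
  ext p r
  rw [mul_row3_apply, row3_mul_lift3_apply]
  exact Algebra.commutes _ _

variable {z : Fin n → A} {X : Matrix (Fin n) (Fin n) A}

theorem m1_mul_row3_of_col
    (h : ∀ i k l, X i k * z l = ca k l • (z l * X i k) + cb l k • (z k * X i l)) :
    m1 n A X * row3 z = row3 z * (lift3 (m1 n A X) * R13 n A) := by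
  ext ⟨i, j⟩ ⟨⟨k, l⟩, m⟩
  rw [mul_row3_apply, ← Matrix.mul_assoc, mul_legR (fun _ => rfl)]
  simp only [row3_mul_lift3_apply, m1_apply, sw13]
  split_ifs <;> simp [h]

theorem m2_mul_row3_of_col
    (h : ∀ i k l, X i k * z l = ca k l • (z l * X i k) + cb l k • (z k * X i l)) :
    m2 n A X * row3 z = row3 z * (lift3 (m2 n A X) * R23 n A) := by
  ext ⟨i, j⟩ ⟨⟨k, l⟩, m⟩
  rw [mul_row3_apply, ← Matrix.mul_assoc, mul_legR (fun _ => rfl)]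
  simp only [row3_mul_lift3_apply, m2_apply, sw23]
  split_ifs <;> simp [h]

theorem m1_mul_row3_of_row
    (h : ∀ i k l, X i k * z l =
      ca i l • (z l * X i k) + if i = l then ∑ m, cb m i • (z m * X m k) else 0) :
    m1 n A X * row3 z = row3 z * (R31 n A * lift3 (m1 n A X)) := by
  ext ⟨i, j⟩ ⟨⟨k, l⟩, m⟩
  rw [mul_row3_apply, row3_mul_apply]
  simp only [legR_mul, lift3_apply, m1_apply, sw13, mul_add, mul_smul_comm,
    Finset.sum_add_distrib]
  by_cases hj : j = l <;> by_cases hi : i = m <;> simp [hj, hi, h, ca_comm]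

theorem m2_mul_row3_of_row
    (h : ∀ i k l, X i k * z l =
      ca i l • (z l * X i k) + if i = l then ∑ m, cb m i • (z m * X m k) else 0) :
    m2 n A X * row3 z = row3 z * (R32 n A * lift3 (m2 n A X)) := by
  ext ⟨i, j⟩ ⟨⟨k, l⟩, m⟩
  rw [mul_row3_apply, row3_mul_apply]
  simp only [legR_mul, lift3_apply, m2_apply, sw23, mul_add, mul_smul_comm,
    Finset.sum_add_distrib]
  by_cases hi : i = k <;> by_cases hj : j = m <;> simp [hj, hi, h, ca_comm]

end ThreeLegs

section RowOscillators

variable {n}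

/-- The operator with prescribed values on the basis. -/
def opOf {I : Type} (g : I → I →₀ K) : Op I := Finsupp.linearCombination K g

theorem opOf_bv {I : Type} (g : I → I →₀ K) (ν : I) : opOf g (bv ν) = g ν := by
  simp [opOf]

/-- The unit occupation vector. -/
abbrev unitOcc (k : Fin n) : Fin n → ℕ := Pi.single k 1

/-- The partial sum `Σ_{j < t} μ_j`. -/
def psum (t : ℕ) (μ : Fin n → ℕ) : ℤ := ∑ j : Fin n, if j.val < t then (μ j : ℤ) else 0

theorem psum_add (t : ℕ) (μ ν : Fin n → ℕ) : psum t (μ + ν) = psum t μ + psum t ν := by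
  simp only [psum, ← Finset.sum_add_distrib]
  refine Finset.sum_congr rfl fun j _ => ?_
  split_ifs <;> simp

theorem psum_unitOcc (t : ℕ) (k : Fin n) : psum t (unitOcc k) = if k.val < t then 1 else 0 := by
  rw [psum, Finset.sum_eq_single k]
  · simp
  · intro j _ hj
    simp [hj]
  · simp

theorem sum_lt_succ {M : Type} [AddCommMonoid M] (k : Fin n) (f : Fin n → M) :
    (∑ j : Fin n, if j.val < k.val + 1 then f j else 0) =
      (∑ j : Fin n, if j.val < k.val then f j else 0) + f k := by
  have h : ∀ j : Fin n, (if j.val < k.val + 1 then f j else 0) =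
      (if j.val < k.val then f j else 0) + if j = k then f j else 0 := by
    intro j
    rcases lt_trichotomy j k with hj | rfl | hj
    · have := Fin.lt_def.1 hj
      simp [this, hj.ne, Nat.lt_succ_of_lt this]
    · simp
    · have := Fin.lt_def.1 hj
      rw [if_neg (by omega), if_neg (by omega), if_neg hj.ne', add_zero]
  simp only [h, Finset.sum_add_distrib]
  simp

theorem psum_succ (k : Fin n) (μ : Fin n → ℕ) : psum (k + 1) μ = psum k μ + μ k :=
  sum_lt_succ k _

/-- The creation operators of a row of `q`-oscillators. -/
def zop (k : Fin n) : Op (Fin n → ℕ) := opOf fun μ => qq ^ psum k μ • bv (μ + unitOcc k)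

/-- The coefficients of the upper triangular hopping operators. -/
def lamC (i k : Fin n) (μ : Fin n → ℕ) : K :=
  if i = k then qq ^ μ i
  else if i < k then (qq ^ (2 * μ i) - 1) * qq ^ (psum k μ - psum i μ - μ i - 1) else 0

/-- The coefficients of the lower triangular hopping operators. -/
def ellC (i k : Fin n) (μ : Fin n → ℕ) : K :=
  if i = k then qq ^ μ i
  else if k < i then (qq ^ (2 * μ i) - 1) * qq ^ (psum i μ - psum k μ - μ k - 1) else 0

/-- The upper triangular matrix of hopping operators. -/
def lamOp : Matrix (Fin n) (Fin n) (Op (Fin n → ℕ)) := fun i k =>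
  opOf fun μ => lamC i k μ • bv (μ + unitOcc k - unitOcc i)

/-- The lower triangular matrix of hopping operators. -/
def ellOp : Matrix (Fin n) (Fin n) (Op (Fin n → ℕ)) := fun i k =>
  opOf fun μ => ellC i k μ • bv (μ + unitOcc k - unitOcc i)

theorem zop_bv (k : Fin n) (μ : Fin n → ℕ) :
    zop k (bv μ) = qq ^ psum k μ • bv (μ + unitOcc k) := opOf_bv _ _

theorem lamOp_bv (i k : Fin n) (μ : Fin n → ℕ) :
    lamOp i k (bv μ) = lamC i k μ • bv (μ + unitOcc k - unitOcc i) := opOf_bv _ _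

theorem ellOp_bv (i k : Fin n) (μ : Fin n → ℕ) :
    ellOp i k (bv μ) = ellC i k μ • bv (μ + unitOcc k - unitOcc i) := opOf_bv _ _

theorem exists_eq_add_unitOcc {μ : Fin n → ℕ} {i : Fin n} (h : μ i ≠ 0) :
    ∃ ρ, μ = ρ + unitOcc i := by
  refine ⟨μ - unitOcc i, (tsub_add_cancel_of_le fun j => ?_).symm⟩
  rcases eq_or_ne j i with rfl | hj
  · simpa using Nat.one_le_iff_ne_zero.2 h
  · simp [hj]

theorem add_unitOcc_sub (ρ : Fin n → ℕ) (i k : Fin n) :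
    ρ + unitOcc i + unitOcc k - unitOcc i = ρ + unitOcc k := by
  rw [add_right_comm, add_tsub_cancel_right]

theorem zop_mul_zop {k l : Fin n} (h : k < l) : zop l * zop k = qq • (zop k * zop l) := by
  have h' : ¬ (l.val < k.val) := by simpa using h.le
  refine Op.ext_bv fun μ => ?_
  simp only [Module.End.mul_apply, LinearMap.smul_apply, zop_bv, map_smul, smul_smul, psum_add,
    psum_unitOcc, if_pos (Fin.lt_def.1 h), if_neg h', zpow_add₀ qq_ne_zero, zpow_one, add_zero,
    add_right_comm μ (unitOcc k)]
  match_scalars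
  ring

theorem lamC_of_lt {i k : Fin n} (h : k < i) (μ : Fin n → ℕ) : lamC i k μ = 0 := by
  simp [lamC, h.ne', h.not_gt]

theorem ellC_of_lt {i k : Fin n} (h : i < k) (μ : Fin n → ℕ) : ellC i k μ = 0 := by
  simp [ellC, h.ne, h.not_gt]

theorem lamC_of_eq_zero {i k : Fin n} (h : i ≠ k) {μ : Fin n → ℕ} (hμ : μ i = 0) :
    lamC i k μ = 0 := by
  simp [lamC, h, hμ]

theorem ellC_of_eq_zero {i k : Fin n} (h : i ≠ k) {μ : Fin n → ℕ} (hμ : μ i = 0) :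
    ellC i k μ = 0 := by
  simp [ellC, h, hμ]

theorem lamC_add (i k l : Fin n) (ρ : Fin n → ℕ) :
    qq ^ psum l (ρ + unitOcc i) * lamC i k (ρ + unitOcc i + unitOcc l) =
      ca k l * (lamC i k (ρ + unitOcc i) * qq ^ psum l (ρ + unitOcc k)) +
        cb l k * (lamC i l (ρ + unitOcc i) * qq ^ psum k (ρ + unitOcc l)) := by
  have hq := qq_ne_zero
  simp only [lamC, ca, cb, psum_add, psum_unitOcc, Pi.add_apply, Pi.single_apply]
  rcases lt_trichotomy i k with h1 | h1 | h1 <;> rcases lt_trichotomy k l with h2 | h2 | h2 <;>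
    rcases lt_trichotomy i l with h3 | h3 | h3
  all_goals first | (exfalso; order) | skip
  all_goals try subst h1
  all_goals try subst h2
  all_goals try subst h3
  all_goals
    simp [*, ne_of_lt, ne_of_gt, not_lt_of_gt, zpow_add₀ hq, zpow_sub₀ hq]
  all_goals first | ring1 | (field_simp; done) | (field_simp; ring1)

theorem lamOp_mul_zop (i k l : Fin n) :
    lamOp i k * zop l = ca k l • (zop l * lamOp i k) + cb l k • (zop k * lamOp i l) := by
  refine Op.ext_bv fun μ => ?_
  simp only [Module.End.mul_apply, LinearMap.add_apply, LinearMap.smul_apply, zop_bv, lamOp_bv,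
    map_smul, smul_smul]
  by_cases hμ : μ i = 0
  · rcases eq_or_ne i k with rfl | hik
    · rcases lt_or_ge l i with hl | hl
      · rw [lamC_of_lt hl]
        simp [lamC, ca, hl.ne', hμ]
      · rw [cb_of_le hl]
        rcases eq_or_ne i l with rfl | hl'
        · simp [lamC, ca, hμ, mul_comm]
        · simp [lamC, ca, hl', hμ]
    · rw [lamC_of_eq_zero hik hμ]
      rcases eq_or_ne i l with rfl | hil
      · rcases lt_or_ge i k with hk | hk
        · simp only [lamC, cb, hk, hk.ne, psum_add, psum_unitOcc, hμ, Pi.add_apply,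
            Pi.single_eq_same, if_true, if_false, add_tsub_cancel_right, add_unitOcc_sub, zero_mul,
            mul_zero, zero_smul, zero_add]
          congr 1
          have hq := qq_ne_zero
          simp [zpow_add₀ hq, zpow_sub₀ hq, Fin.lt_def.1 hk]
          field_simp
        · rw [lamC_of_lt (lt_of_le_of_ne hk hik.symm), cb_of_le hk]
          simp
      · rw [lamC_of_eq_zero hik (by simp [hμ, hil]), lamC_of_eq_zero hil hμ]
        simp
  · obtain ⟨ρ, rfl⟩ := exists_eq_add_unitOcc hμ
    have h1 : ρ + unitOcc i + unitOcc l + unitOcc k - unitOcc i = ρ + unitOcc k + unitOcc l := by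
      rw [show ρ + unitOcc i + unitOcc l + unitOcc k = ρ + unitOcc k + unitOcc l + unitOcc i by
        abel, add_tsub_cancel_right]
    rw [h1, add_unitOcc_sub, add_unitOcc_sub, add_right_comm ρ (unitOcc l), lamC_add, add_smul]

theorem ellC_add {i l : Fin n} (k : Fin n) (h : i ≠ l) (ρ : Fin n → ℕ) :
    qq ^ psum l (ρ + unitOcc i) * ellC i k (ρ + unitOcc i + unitOcc l) =
      ellC i k (ρ + unitOcc i) * qq ^ psum l (ρ + unitOcc k) := by
  have hq := qq_ne_zero
  simp only [ellC, psum_add, psum_unitOcc, Pi.add_apply, Pi.single_apply]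
  rcases lt_trichotomy i k with h1 | h1 | h1 <;> rcases lt_trichotomy k l with h2 | h2 | h2 <;>
    rcases h.lt_or_gt with h3 | h3
  all_goals first | (exfalso; order) | skip
  all_goals try subst h1
  all_goals try subst h2
  all_goals
    simp [*, ne_of_lt, ne_of_gt, not_lt_of_gt, zpow_add₀ hq, zpow_sub₀ hq]
  all_goals first | ring1 | field_simp

/-- The coefficients of the products `z_i L_ik`. -/
def zellC (i k : Fin n) (μ : Fin n → ℕ) : K :=
  if i = k then qq ^ (psum k μ + μ k)
  else if k < i then (qq ^ (2 * μ i) - 1) * qq ^ (2 * psum i μ - psum k μ - μ k) else 0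

theorem zop_ellOp_bv (i k : Fin n) (μ : Fin n → ℕ) :
    zop i (ellOp i k (bv μ)) = zellC i k μ • bv (μ + unitOcc k) := by
  rw [ellOp_bv, map_smul, zop_bv, smul_smul]
  rcases lt_trichotomy i k with h | rfl | h
  · rw [ellC_of_lt h, zellC, if_neg h.ne, if_neg h.not_gt, zero_mul, zero_smul, zero_smul]
  · rw [add_tsub_cancel_right, ellC, zellC, if_pos rfl, if_pos rfl, zpow_add₀ qq_ne_zero, mul_comm,
      zpow_natCast]
  · by_cases hμ : μ i = 0
    · rw [ellC_of_eq_zero h.ne' hμ]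
      simp [zellC, h.ne', hμ]
    · obtain ⟨ρ, rfl⟩ := exists_eq_add_unitOcc hμ
      rw [add_right_comm, add_tsub_cancel_right]
      congr 1
      simp only [ellC, zellC, h.ne', h, if_true, if_false, mul_assoc, ← zpow_add₀ qq_ne_zero,
        psum_add, psum_unitOcc, lt_irrefl, Fin.val_fin_lt, h.not_gt]
      congr 2
      ring

theorem sum_zellC (k : Fin n) (μ : Fin n → ℕ) (t : ℕ) (ht : t ≤ n) :
    (∑ m : Fin n, if m.val < t then zellC m k μ else 0) =
      if k.val < t then qq ^ (2 * psum t μ - psum k μ - μ k) else 0 := by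
  induction t with
  | zero => simp
  | succ t ih =>
    have hs := sum_lt_succ (⟨t, ht⟩ : Fin n) fun m => zellC m k μ
    have hp := psum_succ (⟨t, ht⟩ : Fin n) μ
    simp only at hs hp
    rw [hs, ih (by omega), hp]
    rcases lt_trichotomy k.val t with h | h | h
    · rw [if_pos h, if_pos (by omega), zellC, if_neg (by rintro rfl; exact h.ne rfl),
        if_pos (Fin.lt_def.2 h)]
      rw [show 2 * (psum t μ + (μ ⟨t, ht⟩ : ℤ)) - psum k μ - μ k =
        (2 * μ ⟨t, ht⟩ : ℕ) + (2 * psum t μ - psum k μ - μ k) by push_cast; ring,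
        zpow_add₀ qq_ne_zero, zpow_natCast]
      ring
    · obtain rfl : k = ⟨t, ht⟩ := Fin.ext h
      rw [if_neg (by simp), if_pos (by simp), zellC, if_pos rfl, zero_add]
      congr 1
      ring
    · rw [if_neg (by omega), if_neg (by omega), zellC, if_neg (by rintro rfl; exact h.ne rfl),
        if_neg (by simpa [Fin.lt_def] using h.le), zero_add]

theorem ellOp_mul_zop (i k l : Fin n) :
    ellOp i k * zop l = ca i l • (zop l * ellOp i k) +
      if i = l then ∑ m, cb m i • (zop m * ellOp m k) else 0 := by
  refine Op.ext_bv fun μ => ?_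
  rcases eq_or_ne i l with rfl | hil
  · have hsum : ∑ m, cb m i * zellC m k μ =
        (qq - qq⁻¹) * if k < i then qq ^ (2 * psum i μ - psum k μ - μ k) else 0 := by
      have := sum_zellC k μ i i.2.le
      simp only [Fin.val_fin_lt] at this
      rw [← this, Finset.mul_sum]
      refine Finset.sum_congr rfl fun m _ => ?_
      simp only [cb]
      split_ifs <;> simp
    simp only [if_true, Module.End.mul_apply, LinearMap.add_apply, LinearMap.smul_apply,
      LinearMap.sum_apply, zop_ellOp_bv, smul_smul, ← Finset.sum_smul, hsum, ca_self]
    rw [zop_bv, map_smul, ellOp_bv, smul_smul, add_right_comm, add_tsub_cancel_right, ← add_smul]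
    congr 1
    have hq := qq_ne_zero
    simp only [ellC, zellC, psum_add, psum_unitOcc, Pi.add_apply, Pi.single_apply]
    rcases lt_trichotomy i k with h1 | h1 | h1
    all_goals try subst h1
    all_goals
      simp [*, ne_of_lt, ne_of_gt, not_lt_of_gt, zpow_add₀ hq, zpow_sub₀ hq, two_mul]
    all_goals first | ring1 | (field_simp; done) | (field_simp; ring1)
  · simp only [if_neg hil, ca_of_ne hil, one_smul, add_zero, Module.End.mul_apply, zop_bv,
      ellOp_bv, map_smul, smul_smul]
    by_cases hμ : μ i = 0
    · rcases eq_or_ne i k with rfl | hik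
      · simp [ellC, hil, hμ]
      · rw [ellC_of_eq_zero hik hμ, ellC_of_eq_zero hik (by simp [hμ, hil])]
        simp
    · obtain ⟨ρ, rfl⟩ := exists_eq_add_unitOcc hμ
      have h1 : ρ + unitOcc i + unitOcc l + unitOcc k - unitOcc i = ρ + unitOcc k + unitOcc l := by
        rw [show ρ + unitOcc i + unitOcc l + unitOcc k = ρ + unitOcc k + unitOcc l + unitOcc i by
          abel, add_tsub_cancel_right]
      rw [h1, add_unitOcc_sub, ellC_add k hil]

end RowOscillators

section RowRelations

variable {n}

theorem mul_intertwine {J J' A : Type} [Fintype J] [Fintype J'] [Ring A] {Z : Matrix J J' A}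
    {M N : Matrix J J A} {M' N' : Matrix J' J' A} (hM : M * Z = Z * M') (hN : N * Z = Z * N') :
    M * N * Z = Z * (M' * N') := by
  rw [Matrix.mul_assoc, hN, ← Matrix.mul_assoc, hM, Matrix.mul_assoc]

theorem sub_intertwine {J J' A : Type} [Fintype J] [Fintype J'] [Ring A] {Z : Matrix J J' A}
    {M N : Matrix J J A} {M' N' : Matrix J' J' A} (hM : M * Z = Z * M') (hN : N * Z = Z * N') :
    (M - N) * Z = Z * (M' - N') := by
  rw [Matrix.sub_mul, Matrix.mul_sub, hM, hN]

/-- `M` acts on the vacuum through the scalar matrix `C`. -/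
def Vac {J J' : Type} (C : Matrix J J' K) (M : Matrix J J' (Op (Fin n → ℕ))) : Prop :=
  ∀ p r, M p r (bv 0) = C p r • bv 0

theorem Vac.mul {J : Type} [Fintype J] {C D : Matrix J J K} {M N : Matrix J J (Op (Fin n → ℕ))}
    (hM : Vac C M) (hN : Vac D N) : Vac (C * D) (M * N) := fun p r => by
  simp only [Matrix.mul_apply, LinearMap.sum_apply, Module.End.mul_apply, hN _ _, map_smul, hM _ _,
    Finset.sum_smul, smul_smul]
  exact Finset.sum_congr rfl fun _ _ => by rw [mul_comm]

theorem Vac.ext (C : Matrix (Idx n) (Idx n) K) : Vac C (ext n (Op (Fin n → ℕ)) C) := fun p r => by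
  simp only [Rmatrix.ext, Matrix.map_apply, Module.algebraMap_end_apply]

theorem Vac.m1 {M : Matrix (Fin n) (Fin n) (Op (Fin n → ℕ))} (h : Vac 1 M) :
    Vac 1 (m1 n _ M) := fun p r => by
  rw [← m1_one (n := n) (A := K), m1_apply, m1_apply]
  split_ifs
  · exact h _ _
  · simp

theorem Vac.m2 {M : Matrix (Fin n) (Fin n) (Op (Fin n → ℕ))} (h : Vac 1 M) :
    Vac 1 (m2 n _ M) := fun p r => by
  rw [← m2_one (n := n) (A := K), m2_apply, m2_apply]
  split_ifs
  · exact h _ _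
  · simp

/-- All entries of `M` annihilate the basis vector of `ν`. -/
def Kills {I J J' : Type} (ν : I) (M : Matrix J J' (Op I)) : Prop := ∀ p r, M p r (bv ν) = 0

theorem Kills.legR_mul {I J : Type} {ν : I} {M : Matrix (Idx3 n) J (Op I)} (h : Kills ν M)
    (u v : Idx3 n → Fin n) (s : Idx3 n → Idx3 n) : Kills ν (legR (Op I) u v s * M) := fun p r => by
  rw [Statement6.legR_mul, LinearMap.add_apply, LinearMap.smul_apply, LinearMap.smul_apply, h, h]
  simp

theorem Kills.mul_legR {I J : Type} {ν : I} {M : Matrix J (Idx3 n) (Op I)} (h : Kills ν M)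
    (u v : Idx3 n → Fin n) {s : Idx3 n → Idx3 n} (hs : ∀ p, s (s p) = p) :
    Kills ν (M * legR (Op I) u v s) := fun p r => by
  rw [Statement6.mul_legR hs, LinearMap.add_apply, LinearMap.smul_apply, LinearMap.smul_apply, h, h]
  simp

theorem Kills.lift3 {I : Type} {ν : I} {M : Matrix (Idx n) (Idx n) (Op I)} (h : Kills ν M) :
    Kills ν (lift3 M) := fun p r => by
  rw [lift3_apply]
  split_ifs
  · exact h _ _
  · rfl

theorem Vac.kills_sub {J J' : Type} {C D : Matrix J J' K} {M N : Matrix J J' (Op (Fin n → ℕ))}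
    (hM : Vac C M) (hN : Vac D N) (h : C = D) : Kills 0 (M - N) := fun p r => by
  rw [Matrix.sub_apply, LinearMap.sub_apply, hM, hN, h, sub_self]

/-- The vacuum is cyclic for the creation operators. -/
theorem eq_zero_of_kills {E : Matrix (Idx n) (Idx n) (Op (Fin n → ℕ))} (h0 : Kills 0 E)
    {E' : Matrix (Idx3 n) (Idx3 n) (Op (Fin n → ℕ))} (hE : E * row3 (zop (n := n)) = row3 (zop (n := n)) * E')
    (hkill : ∀ ν, Kills ν E → Kills ν E') : E = 0 := by
  have key : ∀ N : ℕ, ∀ μ : Fin n → ℕ, ∑ i, μ i = N → Kills μ E := by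
    intro N
    induction N with
    | zero =>
      intro μ hμ
      obtain rfl : μ = 0 := by
        ext i
        exact (Finset.sum_eq_zero_iff.1 hμ) i (Finset.mem_univ i)
      exact h0
    | succ N ih =>
      intro μ hμ
      obtain ⟨m, -, hm⟩ := Finset.exists_ne_zero_of_sum_ne_zero (f := μ) (s := Finset.univ)
        (by omega)
      obtain ⟨ν, rfl⟩ := exists_eq_add_unitOcc hm
      have hν : Kills ν E' := hkill ν (ih ν (by
        simp only [Pi.add_apply, Finset.sum_add_distrib, Finset.sum_pi_single', Finset.mem_univ,
          if_true] at hμ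
        omega))
      intro p r
      have h := congrArg (fun T => T (bv ν)) (congrFun (congrFun hE p) (r, m))
      simp only [mul_row3_apply, row3_mul_apply, LinearMap.sum_apply, Module.End.mul_apply, hν _ _,
        map_zero, Finset.sum_const_zero, zop_bv, map_smul] at h
      exact (smul_eq_zero.1 h).resolve_left (zpow_ne_zero _ qq_ne_zero)
  ext1 p r
  exact Op.ext_bv fun μ => key _ μ rfl p r

theorem vac_lamOp : Vac 1 (lamOp (n := n)) := fun i k => by
  rw [lamOp_bv, Matrix.one_apply]
  split_ifs with h
  · subst h
    simp [lamC]
  · rw [lamC_of_eq_zero h rfl, zero_smul, zero_smul]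

theorem vac_ellOp : Vac 1 (ellOp (n := n)) := fun i k => by
  rw [ellOp_bv, Matrix.one_apply]
  split_ifs with h
  · subst h
    simp [ellC]
  · rw [ellC_of_eq_zero h rfl, zero_smul, zero_smul]

section Intertwiners

variable {A : Type} [Ring A] [Algebra K A] {z : Fin n → A} {X Y : Matrix (Fin n) (Fin n) A}

theorem Rm_col_intertwine
    (hX : ∀ i k l, X i k * z l = ca k l • (z l * X i k) + cb l k • (z k * X i l)) :
    (ext n A (Rm n) * (m1 n A X * m2 n A X) - m2 n A X * m1 n A X * ext n A (Rm n)) * row3 z =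
      row3 z * (lift3 (ext n A (Rm n) * (m1 n A X * m2 n A X) -
        m2 n A X * m1 n A X * ext n A (Rm n)) * R13 n A * R23 n A) := by
  have h1 := m1_mul_row3_of_col hX
  have h2 := m2_mul_row3_of_col hX
  have hR := ext_mul_row3 z (Rm n)
  refine (sub_intertwine (mul_intertwine hR (mul_intertwine h1 h2))
    (mul_intertwine (mul_intertwine h2 h1) hR)).trans (congrArg _ ?_)
  simp only [lift3_sub, lift3_mul, sub_mul, lift3_ext_Rm, mul_assoc]
  congr 1
  · rw [← mul_assoc (R13 n _), R13_comm_m2, mul_assoc]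
  · rw [R12_R13_R23, ← mul_assoc (R23 n _), R23_comm_m1, mul_assoc]

theorem Rm21_row_intertwine
    (hX : ∀ i k l, X i k * z l =
      ca i l • (z l * X i k) + if i = l then ∑ m, cb m i • (z m * X m k) else 0) :
    (ext n A (Rm21 n) * (m1 n A X * m2 n A X) - m2 n A X * m1 n A X * ext n A (Rm21 n)) * row3 z =
      row3 z * (R32 n A * (R31 n A * lift3 (ext n A (Rm21 n) * (m1 n A X * m2 n A X) -
        m2 n A X * m1 n A X * ext n A (Rm21 n)))) := by
  have h1 := m1_mul_row3_of_row hX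
  have h2 := m2_mul_row3_of_row hX
  have hR := ext_mul_row3 z (Rm21 n)
  refine (sub_intertwine (mul_intertwine hR (mul_intertwine h1 h2))
    (mul_intertwine (mul_intertwine h2 h1) hR)).trans (congrArg _ ?_)
  simp only [lift3_sub, lift3_mul, mul_sub, lift3_ext_Rm21, mul_assoc]
  congr 1
  · have h := R32_R31_R21 (n := n) (A := A)
    simp only [← mul_assoc] at h ⊢
    rw [h, mul_assoc _ _ (R32 n A), mul_assoc _ (R32 n A), ← R32_comm_m1, ← mul_assoc]
  · rw [← mul_assoc _ (R31 n _), ← R31_comm_m2, mul_assoc]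

theorem Rm21_row_col_intertwine
    (hX : ∀ i k l, X i k * z l =
      ca i l • (z l * X i k) + if i = l then ∑ m, cb m i • (z m * X m k) else 0)
    (hY : ∀ i k l, Y i k * z l = ca k l • (z l * Y i k) + cb l k • (z k * Y i l)) :
    (m1 n A X * ext n A (Rm21 n) * m2 n A Y - m2 n A Y * ext n A (Rm21 n) * m1 n A X) * row3 z =
      row3 z * (R31 n A * (lift3 (m1 n A X * ext n A (Rm21 n) * m2 n A Y -
        m2 n A Y * ext n A (Rm21 n) * m1 n A X) * R23 n A)) := by
  have h1 := m1_mul_row3_of_row hX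
  have h2 := m2_mul_row3_of_col hY
  have hR := ext_mul_row3 z (Rm21 n)
  refine (sub_intertwine (mul_intertwine (mul_intertwine h1 hR) h2)
    (mul_intertwine (mul_intertwine h2 hR) h1)).trans (congrArg _ ?_)
  simp only [lift3_sub, lift3_mul, mul_sub, sub_mul, lift3_ext_Rm21, mul_assoc]
  congr 1
  rw [← mul_assoc (R21 n _) (R31 n _), ← mul_assoc (R23 n _), R23_R21_R31, mul_assoc,
    ← mul_assoc _ (R31 n _), ← R31_comm_m2]
  simp only [mul_assoc]
  rw [R23_comm_m1]

end Intertwiners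

theorem Rm_lamOp_lamOp : ext n _ (Rm n) * (m1 n _ lamOp * m2 n _ lamOp) =
    m2 n _ lamOp * m1 n _ lamOp * ext n _ (Rm n) :=
  sub_eq_zero.1 <| eq_zero_of_kills
    (((Vac.ext _).mul (vac_lamOp.m1.mul vac_lamOp.m2)).kills_sub
      ((vac_lamOp.m2.mul vac_lamOp.m1).mul (Vac.ext _)) (by simp))
    (Rm_col_intertwine (A := Op (Fin n → ℕ)) lamOp_mul_zop)
    fun _ h => (h.lift3.mul_legR _ _ fun _ => rfl).mul_legR _ _ fun _ => rfl

theorem Rm21_ellOp_ellOp : ext n _ (Rm21 n) * (m1 n _ ellOp * m2 n _ ellOp) =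
    m2 n _ ellOp * m1 n _ ellOp * ext n _ (Rm21 n) :=
  sub_eq_zero.1 <| eq_zero_of_kills
    (((Vac.ext _).mul (vac_ellOp.m1.mul vac_ellOp.m2)).kills_sub
      ((vac_ellOp.m2.mul vac_ellOp.m1).mul (Vac.ext _)) (by simp))
    (Rm21_row_intertwine (A := Op (Fin n → ℕ)) ellOp_mul_zop)
    fun _ h => (h.lift3.legR_mul _ _ _).legR_mul _ _ _

theorem ellOp_Rm21_lamOp : m1 n _ ellOp * ext n _ (Rm21 n) * m2 n _ lamOp =
    m2 n _ lamOp * ext n _ (Rm21 n) * m1 n _ ellOp :=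
  sub_eq_zero.1 <| eq_zero_of_kills
    (((vac_ellOp.m1.mul (Vac.ext _)).mul vac_lamOp.m2).kills_sub
      ((vac_lamOp.m2.mul (Vac.ext _)).mul vac_ellOp.m1) (by simp))
    (Rm21_row_col_intertwine (A := Op (Fin n → ℕ)) ellOp_mul_zop lamOp_mul_zop)
    fun _ h => (h.lift3.mul_legR _ _ fun _ => rfl).legR_mul _ _ _

end RowRelations

section Coordinates

variable {ι S : Type} [DecidableEq ι]

/-- The embedding of the free space on `S` along the coordinate `r` through the point `μ`. -/
def axis (μ : ι → S) (r : ι) : (S →₀ K) →ₗ[K] ((ι → S) →₀ K) :=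
  Finsupp.lmapDomain K K (Function.update μ r)

theorem axis_bv (μ : ι → S) (r : ι) (x : S) : axis μ r (bv x) = bv (Function.update μ r x) :=
  Finsupp.mapDomain_single

theorem axis_update (μ : ι → S) (r : ι) (x : S) : axis (Function.update μ r x) r = axis μ r :=
  Finsupp.lhom_ext' fun y => LinearMap.ext_ring <| by
    simp only [LinearMap.comp_apply, Finsupp.lsingle_apply, axis_bv, Function.update_idem]

/-- The operator acting by `T` on the coordinate `r`. -/
def coordFun (r : ι) (T : Op S) : Op (ι → S) := opOf fun μ => axis μ r (T (bv (μ r)))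

theorem coordFun_bv (r : ι) (T : Op S) (μ : ι → S) :
    coordFun r T (bv μ) = axis μ r (T (bv (μ r))) := opOf_bv _ _

theorem coordFun_axis (r : ι) (T : Op S) (μ : ι → S) (v : S →₀ K) :
    coordFun r T (axis μ r v) = axis μ r (T v) := by
  have h : (coordFun r T).comp (axis μ r) = (axis μ r).comp T :=
    Finsupp.lhom_ext' fun y => LinearMap.ext_ring <| by
      simp only [LinearMap.comp_apply, Finsupp.lsingle_apply, axis_bv, coordFun_bv, axis_update,
        Function.update_self]
  exact LinearMap.congr_fun h v

/-- Operators acting on a single coordinate. -/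
def coord (r : ι) : Op S →ₐ[K] Op (ι → S) :=
  AlgHom.ofLinearMap
    { toFun := coordFun r
      map_add' := fun T U => Op.ext_bv fun μ => by
        simp only [coordFun_bv, LinearMap.add_apply, map_add]
      map_smul' := fun c T => Op.ext_bv fun μ => by
        simp only [coordFun_bv, LinearMap.smul_apply, map_smul, RingHom.id_apply] }
    (Op.ext_bv fun μ => by
      simp [coordFun_bv, axis_bv])
    fun T U => Op.ext_bv fun μ => by
      simp only [LinearMap.coe_mk, AddHom.coe_mk, Module.End.mul_apply, coordFun_bv, coordFun_axis]

theorem coord_bv (r : ι) (T : Op S) (μ : ι → S) :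
    coord r T (bv μ) = axis μ r (T (bv (μ r))) := coordFun_bv r T μ

theorem axis_eq_sum (μ : ι → S) (r : ι) (v : S →₀ K) :
    axis μ r v = v.sum fun x c => c • bv (Function.update μ r x) := by
  conv_lhs => rw [← Finsupp.sum_single v]
  rw [map_finsuppSum]
  refine Finsupp.sum_congr fun x _ => ?_
  rw [← axis_bv, ← map_smul, Finsupp.smul_single_one]

theorem coord_commute {r s : ι} (h : r ≠ s) (T U : Op S) :
    coord r T * coord s U = coord s U * coord r T := by
  have key : ∀ {r s : ι} (_ : r ≠ s) (T U : Op S) (μ : ι → S),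
      (coord r T * coord s U) (bv μ) = (U (bv (μ s))).sum fun x c => (T (bv (μ r))).sum fun y d =>
        c • d • bv (Function.update (Function.update μ s x) r y) := by
    intro r s h T U μ
    rw [Module.End.mul_apply, coord_bv, axis_eq_sum, map_finsuppSum]
    refine Finsupp.sum_congr fun x _ => ?_
    rw [map_smul, coord_bv, axis_eq_sum, Finsupp.smul_sum, Function.update_of_ne h]
  refine Op.ext_bv fun μ => ?_
  rw [key h, key h.symm, Finsupp.sum_comm]
  refine Finsupp.sum_congr fun y _ => Finsupp.sum_congr fun x _ => ?_
  rw [smul_comm, Function.update_comm h]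

variable [Fintype ι]

/-- The total weight of a family. -/
def totalWt (w : ι → S → ℤ) (μ : ι → S) : ℤ := ∑ s, w s (μ s)

theorem totalWt_add [Add S] {w : ι → S → ℤ} (h : ∀ s x y, w s (x + y) = w s x + w s y)
    (μ ν : ι → S) : totalWt w (μ + ν) = totalWt w μ + totalWt w ν := by
  simp only [totalWt, Pi.add_apply, h, Finset.sum_add_distrib]

theorem totalWt_update (w : ι → S → ℤ) (μ : ι → S) (r : ι) (x : S) :
    totalWt w (Function.update μ r x) = totalWt w μ - w r (μ r) + w r x := by
  have h1 := Finset.add_sum_erase Finset.univ (fun s => w s (μ s)) (Finset.mem_univ r)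
  have h2 := Finset.add_sum_erase Finset.univ (fun s => w s (Function.update μ r x s))
    (Finset.mem_univ r)
  rw [Function.update_self, Finset.sum_congr rfl fun s hs => by
    rw [Function.update_of_ne (Finset.ne_of_mem_erase hs)]] at h2
  simp only [totalWt]
  linarith

theorem totalWt_single [Zero S] {w : ι → S → ℤ} (h : ∀ s, w s 0 = 0) (r : ι) (x : S) :
    totalWt w (Pi.single r x) = w r x := by
  rw [totalWt, Finset.sum_eq_single r]
  · rw [Pi.single_eq_same]
  · intro s _ hs
    rw [Pi.single_eq_of_ne hs, h]
  · simp

theorem axis_mem_wLe {w : ι → S → ℤ} (μ : ι → S) (r : ι) {v : S →₀ K} {k l : ℤ}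
    (hv : v ∈ wLe (w r) k) (hl : totalWt w μ - w r (μ r) + k ≤ l) :
    axis μ r v ∈ wLe (totalWt w) l := by
  rw [axis_eq_sum]
  refine Submodule.sum_mem _ fun x hx => Submodule.smul_mem _ _ (bv_mem_wLe ?_)
  have : w r x ≤ k := (Finsupp.mem_supported K v).1 hv hx
  rw [totalWt_update]
  linarith

theorem DegLe.coord {w : ι → S → ℤ} {r : ι} {T : Op S} {d : ℤ} (h : DegLe (w r) T d) :
    DegLe (totalWt w) (coord r T) d := fun μ => by
  rw [coord_bv]
  exact axis_mem_wLe μ r (h (μ r)) (by linarith)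

theorem Lead.coord [AddCommMonoid S] {w : ι → S → ℤ} (h0 : ∀ s, w s 0 = 0) {r : ι} {T : Op S}
    {x : S} (h : Lead (w r) T x) : Lead (totalWt w) (coord r T) (Pi.single r x) := fun μ => by
  obtain ⟨c, hc0, hc⟩ := h (μ r)
  refine ⟨c, hc0, ?_⟩
  have e : Pi.single r x + μ = Function.update μ r (x + μ r) := by
    ext1 s
    rcases eq_or_ne s r with rfl | hs
    · simp
    · simp [hs]
  rw [coord_bv, e, ← axis_bv, ← map_smul, ← map_sub, totalWt_single h0]
  exact axis_mem_wLe μ r hc (by linarith)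

end Coordinates

section BlockStep

variable {n} {A B : Type} [Ring A] [Algebra K A] [Ring B] [Algebra K B]

/-- The relations between the creation operators and the hopping operators of a row. -/
structure RowRel (z : Fin n → A) (U V : Matrix (Fin n) (Fin n) A) : Prop where
  z_z {k l : Fin n} (h : k < l) : z l * z k = qq • (z k * z l)
  u_z (i k l : Fin n) : U i k * z l = ca k l • (z l * U i k) + cb l k • (z k * U i l)
  v_z (i k l : Fin n) : V i k * z l =
    ca i l • (z l * V i k) + if i = l then ∑ m, cb m i • (z m * V m k) else 0
  u_u : ext n A (Rm n) * (m1 n A U * m2 n A U) = m2 n A U * m1 n A U * ext n A (Rm n)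
  v_v : ext n A (Rm21 n) * (m1 n A V * m2 n A V) = m2 n A V * m1 n A V * ext n A (Rm21 n)
  v_u : m1 n A V * ext n A (Rm21 n) * m2 n A U = m2 n A U * ext n A (Rm21 n) * m1 n A V

theorem rowRel_zop : RowRel (zop (n := n)) lamOp ellOp where
  z_z := zop_mul_zop
  u_z := lamOp_mul_zop
  v_z := ellOp_mul_zop
  u_u := Rm_lamOp_lamOp
  v_v := Rm21_ellOp_ellOp
  v_u := ellOp_Rm21_lamOp

theorem RowRel.map {z : Fin n → A} {U V : Matrix (Fin n) (Fin n) A} (h : RowRel z U V)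
    (f : A →ₐ[K] B) : RowRel (fun k => f (z k)) (U.map f) (V.map f) where
  z_z hkl := by simpa using congrArg f (h.z_z hkl)
  u_z i k l := by simpa using congrArg f (h.u_z i k l)
  v_z i k l := by simpa [apply_ite f] using congrArg f (h.v_z i k l)
  u_u := by
    simpa only [Matrix.map_mul, map_ext, map_m1, map_m2] using congrArg (fun M => M.map f) h.u_u
  v_v := by
    simpa only [Matrix.map_mul, map_ext, map_m1, map_m2] using congrArg (fun M => M.map f) h.v_v
  v_u := by
    simpa only [Matrix.map_mul, map_ext, map_m1, map_m2] using congrArg (fun M => M.map f) h.v_u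

/-- The relations between the two halves of a block. -/
structure BlockRel (Y L : Matrix (Fin n) (Fin n) A) : Prop where
  y_y : FRT Y
  l_l : ext n A (Rm21 n) * (m1 n A L * m2 n A L) = m2 n A L * m1 n A L * ext n A (Rm21 n)
  l_y : m1 n A L * m2 n A Y = m2 n A Y * ext n A (Rm21 n) * m1 n A L

theorem BlockRel.map {Y L : Matrix (Fin n) (Fin n) A} (h : BlockRel Y L) (f : A →ₐ[K] B) :
    BlockRel (Y.map f) (L.map f) where
  y_y i j k l := by simpa using congrArg f (h.y_y i j k l)
  l_l := by
    simpa only [Matrix.map_mul, map_ext, map_m1, map_m2] using congrArg (fun M => M.map f) h.l_l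
  l_y := by
    simpa only [Matrix.map_mul, map_ext, map_m1, map_m2] using congrArg (fun M => M.map f) h.l_y

/-- The matrix with a single nonzero row. -/
def rowMat (r : Fin n) (z : Fin n → A) : Matrix (Fin n) (Fin n) A :=
  fun i k => if i = r then z k else 0

/-- Adding a new last row to a solution of the FRT relations. -/
theorem FRT.add_row {r : Fin n} {z : Fin n → A} {y : Matrix (Fin n) (Fin n) A} (hy : FRT y)
    (hrow : ∀ i, r ≤ i → ∀ k, y i k = 0) (hzz : ∀ {k l}, k < l → z l * z k = qq • (z k * z l))
    (hyz : ∀ j k l, y j k * z l = ca k l • (z l * y j k) + cb l k • (z k * y j l)) :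
    FRT (y + rowMat r z) := by
  have hq := qq_ne_zero
  have hr : ∀ k, (y + rowMat r z) r k = z k := fun k => by
    simp [rowMat, hrow r le_rfl]
  have hne : ∀ {i}, i ≠ r → ∀ k, (y + rowMat r z) i k = y i k := fun hi k => by
    simp [rowMat, hi]
  intro i j k l
  by_cases hi : i = r <;> by_cases hj : j = r
  · subst hi; subst hj
    simp only [hr, ca_self, cb_self, zero_smul, add_zero]
    rcases lt_trichotomy k l with h | rfl | h
    · rw [ca_of_ne h.ne, cb_of_le h.le, hzz h]
      simp
    · rw [ca_self, cb_self]
      simp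
    · rw [ca_of_ne h.ne', cb_of_lt h, hzz h]
      match_scalars
      field_simp
      ring
  · subst hi
    simp only [hr, hne hj]
    rcases lt_or_ge j i with hji | hji
    · rw [ca_of_ne hji.ne', cb_of_lt hji, hyz, hyz]
      rcases lt_trichotomy k l with h | rfl | h
      · simp only [ca_of_ne h.ne, ca_of_ne h.ne', cb_of_le h.le, cb_of_lt h]
        module
      · simp only [ca_self, cb_self]
        match_scalars
        field_simp
        ring
      · simp only [ca_of_ne h.ne, ca_of_ne h.ne', cb_of_le h.le, cb_of_lt h]
        module
    · simp [hrow j hji]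
  · subst hj
    simp only [hr, hne hi]
    rcases lt_or_ge i j with hij | hij
    · rw [ca_of_ne hij.ne, cb_of_le hij.le, hyz]
      simp
    · simp [hrow i hij]
  · simp only [hne hi, hne hj]
    exact hy i j k l

theorem BlockRel.step {r : Fin n} {z : Fin n → A} {U V Y L : Matrix (Fin n) (Fin n) A}
    (h : BlockRel Y L) (hz : RowRel z U V) (hrow : ∀ i, r ≤ i → ∀ k, Y i k = 0)
    (hYz : ∀ i j k, Y i j * z k = z k * Y i j) (hYU : ∀ i j k l, Y i j * U k l = U k l * Y i j)
    (hYV : ∀ i j k l, Y i j * V k l = V k l * Y i j)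
    (hLz : ∀ i j k, L i j * z k = z k * L i j) (hLU : ∀ i j k l, L i j * U k l = U k l * L i j)
    (hLV : ∀ i j k l, L i j * V k l = V k l * L i j) :
    BlockRel (Y * U + rowMat r z) (V * L) := by
  have hVL := m1_commute_m2 fun i j k l => (hLV k l i j).symm
  have hLV' := m1_commute_m2 hLV
  have hYU' := m1_commute_m2 hYU
  have hUY := m1_commute_m2 fun i j k l => (hYU k l i j).symm
  have hVY := m1_commute_m2 fun i j k l => (hYV k l i j).symm
  have hLU' := m1_commute_m2 hLU
  constructor
  · refine FRT.add_row ?_ ?_ hz.z_z ?_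
    · refine (frt_iff _).1 ?_
      have h1 := (frt_iff _).2 h.y_y
      simp only [m1_mul, m2_mul, mul_assoc] at h1 ⊢
      rw [← mul_assoc (m1 n A U) (m2 n A Y), hUY, mul_assoc, ← mul_assoc (m1 n A Y),
        ← mul_assoc (ext n A (Rm21 n)), h1]
      simp only [mul_assoc]
      rw [hz.u_u, mul_assoc, ← mul_assoc (m1 n A Y) (m2 n A U), hYU', mul_assoc]
    · intro i hi k
      simp [Matrix.mul_apply, hrow i hi]
    · intro j k l
      simp only [Matrix.mul_apply, Finset.sum_mul, Finset.mul_sum, Finset.smul_sum,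
        ← Finset.sum_add_distrib]
      refine Finset.sum_congr rfl fun m _ => ?_
      rw [mul_assoc, hz.u_z, mul_add, mul_smul_comm, mul_smul_comm, ← mul_assoc, ← mul_assoc, hYz,
        hYz, mul_assoc, mul_assoc]
  · simp only [m1_mul, m2_mul, mul_assoc]
    have hvv := hz.v_v
    have hll := h.l_l
    simp only [mul_assoc] at hvv hll
    rw [← mul_assoc (m1 n A L) (m2 n A V), hLV', mul_assoc, ← mul_assoc (m1 n A V),
      ← mul_assoc (ext n A (Rm21 n)), hvv]
    simp only [mul_assoc]
    rw [hll, ← mul_assoc (m1 n A V) (m2 n A L), hVL, mul_assoc]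
  · have hVZ : m1 n A V * m2 n A (rowMat r z) =
        m2 n A (rowMat r z) * ext n A (Rm21 n) * m1 n A V := by
      ext ⟨i, j⟩ ⟨k, l⟩
      rw [m1_mul_m2, m2_Rm21_m1]
      by_cases hj : j = r
      · simp [rowMat, hj, hz.v_z]
      · simp [rowMat, hj]
    have hLZ : m1 n A L * m2 n A (rowMat r z) = m2 n A (rowMat r z) * m1 n A L := by
      refine m1_commute_m2 fun i j k l => ?_
      by_cases hk : k = r
      · simp [rowMat, hk, hLz]
      · simp [rowMat, hk]
    have hly := h.l_y
    have hvu := hz.v_u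
    simp only [m1_mul, m2_mul, m2_add, mul_add, add_mul, mul_assoc] at hly hvu hVZ ⊢
    congr 1
    · rw [← mul_assoc (m1 n A L) (m2 n A Y), hly]
      simp only [mul_assoc]
      rw [hLU', ← mul_assoc (m1 n A V) (m2 n A Y), hVY, mul_assoc, ← mul_assoc (ext n A (Rm21 n)),
        ← mul_assoc (m1 n A V), hvu]
      simp only [mul_assoc]
    · rw [hLZ, ← mul_assoc, hVZ]
      simp only [mul_assoc]

end BlockStep

section Block

variable {n}

theorem Lead.sum {I σ : Type} [AddCommMonoid I] {wt : I → ℤ} {s : Finset σ} {T : σ → Op I} {μ : I}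
    {i : σ} (hi : i ∈ s) (hT : Lead wt (T i) μ)
    (h : ∀ j ∈ s, j ≠ i → DegLe wt (T j) (wt μ - 1)) : Lead wt (∑ j ∈ s, T j) μ := by
  classical
  rw [← Finset.add_sum_erase s T hi]
  exact hT.add (DegLe.sum _ fun j hj => h j (Finset.mem_of_mem_erase hj) (Finset.ne_of_mem_erase hj))

/-- The weight of the `k`-th occupation number in row `i`. -/
def cellWt (i k : Fin n) : ℤ := n * i + (n - i) * k

/-- The weight function of row `i`. -/
def rowWt (i : Fin n) (μ : Fin n → ℕ) : ℤ := ∑ k, cellWt i k * μ k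

/-- The weight function of a block of rows. -/
abbrev blockWt : (Fin n → Fin n → ℕ) → ℤ := totalWt rowWt

theorem rowWt_add (i : Fin n) (μ ν : Fin n → ℕ) : rowWt i (μ + ν) = rowWt i μ + rowWt i ν := by
  simp only [rowWt, Pi.add_apply, Nat.cast_add, mul_add, Finset.sum_add_distrib]

theorem rowWt_zero (i : Fin n) : rowWt i 0 = 0 := by simp [rowWt]

theorem rowWt_unitOcc (i k : Fin n) : rowWt i (unitOcc k) = cellWt i k := by
  rw [rowWt, Finset.sum_eq_single k]
  · simp
  · intro j _ hj
    simp [hj]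
  · simp

theorem blockWt_single (i k : Fin n) : blockWt (Pi.single i (unitOcc k)) = cellWt i k := by
  rw [blockWt, totalWt_single rowWt_zero, rowWt_unitOcc]

theorem blockWt_add (μ ν : Fin n → Fin n → ℕ) : blockWt (μ + ν) = blockWt μ + blockWt ν :=
  totalWt_add rowWt_add μ ν

theorem blockWt_zero : blockWt (0 : Fin n → Fin n → ℕ) = 0 := by
  simp [blockWt, totalWt, rowWt_zero]

theorem lead_zop (i k : Fin n) : Lead (rowWt i) (zop k) (unitOcc k) := fun μ => by
  refine ⟨qq ^ psum k μ, zpow_ne_zero _ qq_ne_zero, ?_⟩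
  rw [zop_bv, add_comm μ, sub_self]
  exact Submodule.zero_mem _

theorem lead_lamOp_self (i k : Fin n) : Lead (rowWt i) (lamOp k k) 0 := fun μ => by
  refine ⟨lamC k k μ, by simp [lamC, qq_ne_zero], ?_⟩
  rw [lamOp_bv, add_tsub_cancel_right, zero_add, sub_self]
  exact Submodule.zero_mem _

theorem lead_ellOp_self (i k : Fin n) : Lead (rowWt i) (ellOp k k) 0 := fun μ => by
  refine ⟨ellC k k μ, by simp [ellC, qq_ne_zero], ?_⟩
  rw [ellOp_bv, add_tsub_cancel_right, zero_add, sub_self]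
  exact Submodule.zero_mem _

theorem rowWt_hop (t i k : Fin n) {μ : Fin n → ℕ} (h : i = k ∨ μ i ≠ 0) :
    rowWt t (μ + unitOcc k - unitOcc i) = rowWt t μ + (cellWt t k - cellWt t i) := by
  rcases h with rfl | h
  · rw [add_tsub_cancel_right]
    ring
  · obtain ⟨ρ, rfl⟩ := exists_eq_add_unitOcc h
    rw [add_unitOcc_sub, rowWt_add, rowWt_add, rowWt_unitOcc, rowWt_unitOcc]
    ring

theorem degLe_lamOp (t i k : Fin n) : DegLe (rowWt t) (lamOp i k) (cellWt t k - cellWt t i) :=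
  fun μ => by
    rw [lamOp_bv]
    by_cases h : i = k ∨ μ i ≠ 0
    · exact Submodule.smul_mem _ _ (bv_mem_wLe (rowWt_hop t i k h).le)
    · push Not at h
      rw [lamC_of_eq_zero h.1 h.2, zero_smul]
      exact Submodule.zero_mem _

theorem lamOp_of_lt {i k : Fin n} (h : k < i) : lamOp i k = 0 :=
  Op.ext_bv fun μ => by rw [lamOp_bv, lamC_of_lt h, zero_smul, LinearMap.zero_apply]

theorem ellOp_of_lt {i k : Fin n} (h : i < k) : ellOp i k = 0 :=
  Op.ext_bv fun μ => by rw [ellOp_bv, ellC_of_lt h, zero_smul, LinearMap.zero_apply]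

theorem cellWt_le (i : Fin n) {k l : Fin n} (h : k ≤ l) : cellWt i k ≤ cellWt i l := by
  have hi : (i : ℤ) < n := by exact_mod_cast i.2
  have hk : (k : ℤ) ≤ l := by exact_mod_cast h
  simp only [cellWt]
  nlinarith

theorem cellWt_lt {i j : Fin n} (h : i < j) (k : Fin n) : cellWt i k < cellWt j k := by
  have hk : (k : ℤ) < n := by exact_mod_cast k.2
  have hi : (i : ℤ) < j := by exact_mod_cast h
  simp only [cellWt]
  nlinarith

theorem cellWt_add_lt {i j k l : Fin n} (h : i < j) (hkl : k < l) :
    cellWt i k + (cellWt j l - cellWt j k) < cellWt i l := by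
  have hk : (k : ℤ) < l := by exact_mod_cast hkl
  have hi : (i : ℤ) < j := by exact_mod_cast h
  simp only [cellWt]
  nlinarith

theorem degLe_ellOp (t i k : Fin n) : DegLe (rowWt t) (ellOp i k) 0 := by
  rcases lt_or_ge i k with hik | hik
  · rw [ellOp_of_lt hik]
    exact DegLe.zero 0
  intro μ
  rw [ellOp_bv]
  by_cases h : i = k ∨ μ i ≠ 0
  · refine Submodule.smul_mem _ _ (bv_mem_wLe ?_)
    rw [rowWt_hop t i k h]
    have := cellWt_le t hik
    linarith
  · push Not at h
    rw [ellC_of_eq_zero h.1 h.2, zero_smul]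
    exact Submodule.zero_mem _

/-- A block built from its first `t` rows. -/
structure IsBlock (t : ℕ) (Y L : Matrix (Fin n) (Fin n) (Op (Fin n → Fin n → ℕ))) : Prop where
  rel : BlockRel Y L
  row (i : Fin n) (h : t ≤ i) (k : Fin n) : Y i k = 0
  comm_y (s : Fin n) (h : t ≤ s) (T : Op (Fin n → ℕ)) (i j : Fin n) :
    Y i j * coord s T = coord s T * Y i j
  comm_l (s : Fin n) (h : t ≤ s) (T : Op (Fin n → ℕ)) (i j : Fin n) :
    L i j * coord s T = coord s T * L i j
  l_upper {i m : Fin n} (h : i < m) : L i m = 0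
  l_diag (i : Fin n) : Lead blockWt (L i i) 0
  l_deg (i m : Fin n) : DegLe blockWt (L i m) 0
  y_lead (m k : Fin n) (h : (m : ℕ) < t) : Lead blockWt (Y m k) (Pi.single m (unitOcc k))

theorem isBlock_zero : IsBlock (n := n) 0 0 1 where
  rel := by
    refine ⟨fun i j k l => by simp, ?_, ?_⟩
    · rw [m1_one, m2_one]
      simp
    · rw [m1_one]
      ext ⟨i, j⟩ ⟨k, l⟩
      simp [Matrix.mul_apply, m2]
  row i _ k := rfl
  comm_y s _ T i j := by simp
  comm_l s _ T i j := by
    rw [Matrix.one_apply]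
    split_ifs <;> simp
  l_upper h := by rw [Matrix.one_apply_ne h.ne]
  l_diag i := by
    rw [Matrix.one_apply_eq]
    exact Lead.one
  l_deg i m := by
    rw [Matrix.one_apply]
    split_ifs
    · have := (Lead.one (wt := blockWt (n := n))).degLe blockWt_add
      rwa [blockWt_zero] at this
    · exact DegLe.zero 0
  y_lead m k h := absurd h (Nat.not_lt_zero _)

theorem rowRel_coord (t : Fin n) : RowRel (A := Op (Fin n → Fin n → ℕ))
    (fun k => coord t (zop k)) (lamOp.map (coord t)) (ellOp.map (coord t)) := by
  have h := RowRel.map (B := Op (Fin n → Fin n → ℕ)) rowRel_zop (coord t)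
  exact h

theorem IsBlock.succ {t : Fin n} {Y L : Matrix (Fin n) (Fin n) (Op (Fin n → Fin n → ℕ))}
    (h : IsBlock t Y L) :
    IsBlock (t + 1) (Y * lamOp.map (coord t) + rowMat t fun k => coord t (zop k))
      (ellOp.map (coord t) * L) where
  rel := h.rel.step (rowRel_coord t) (fun i hi => h.row i hi)
    (fun i j k => h.comm_y t le_rfl _ i j) (fun i j k l => h.comm_y t le_rfl _ i j)
    (fun i j k l => h.comm_y t le_rfl _ i j) (fun i j k => h.comm_l t le_rfl _ i j)
    (fun i j k l => h.comm_l t le_rfl _ i j) (fun i j k l => h.comm_l t le_rfl _ i j)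
  row i hi k := by
    have hit : i ≠ t := by
      rintro rfl
      omega
    rw [Matrix.add_apply, Matrix.mul_apply, Finset.sum_eq_zero, rowMat, if_neg hit, add_zero]
    intro m _
    rw [h.row i (by omega), zero_mul]
  comm_y s hs T i j := by
    have hst : t ≠ s := by
      rintro rfl
      omega
    rw [Matrix.add_apply, Matrix.mul_apply, add_mul, mul_add, Finset.sum_mul, Finset.mul_sum]
    congr 1
    · refine Finset.sum_congr rfl fun m _ => ?_
      rw [Matrix.map_apply, mul_assoc, coord_commute hst, ← mul_assoc, h.comm_y s (by omega),
        mul_assoc]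
    · rw [rowMat]
      split_ifs
      · exact coord_commute hst _ _
      · rw [zero_mul, mul_zero]
  comm_l s hs T i j := by
    have hst : t ≠ s := by
      rintro rfl
      omega
    rw [Matrix.mul_apply, Finset.sum_mul, Finset.mul_sum]
    refine Finset.sum_congr rfl fun m _ => ?_
    rw [Matrix.map_apply, mul_assoc, h.comm_l s (by omega), ← mul_assoc, coord_commute hst,
      mul_assoc]
  l_upper {i m} him := by
    rw [Matrix.mul_apply]
    refine Finset.sum_eq_zero fun j _ => ?_
    rcases lt_or_ge i j with hij | hij
    · rw [Matrix.map_apply, ellOp_of_lt hij, map_zero, zero_mul]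
    · rw [h.l_upper (hij.trans_lt him), mul_zero]
  l_diag i := by
    have e : (ellOp.map (coord t) * L : Matrix (Fin n) (Fin n) (Op (Fin n → Fin n → ℕ))) i i = coord t (ellOp i i) * L i i := by
      rw [Matrix.mul_apply]
      refine Finset.sum_eq_single_of_mem i (Finset.mem_univ i) fun j _ hj => ?_
      rcases lt_or_gt_of_ne hj with hj | hj
      · rw [h.l_upper hj, mul_zero]
      · rw [Matrix.map_apply, ellOp_of_lt hj, map_zero, zero_mul]
    have h1 := Lead.coord rowWt_zero (lead_ellOp_self t i)
    rw [Pi.single_zero] at h1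
    rw [e, ← add_zero (0 : Fin n → Fin n → ℕ)]
    exact h1.mul blockWt_add (h.l_diag i)
  l_deg i m := by
    rw [Matrix.mul_apply]
    refine DegLe.sum _ fun j _ => ?_
    exact (degLe_ellOp t i j).coord.mul (h.l_deg j m)
  y_lead m k hm := by
    rcases eq_or_ne m t with rfl | hmt
    · have e : (Y * lamOp.map (coord m) + rowMat m fun k => coord m (zop k) :
          Matrix (Fin n) (Fin n) (Op (Fin n → Fin n → ℕ))) m k = coord m (zop k) := by
        rw [Matrix.add_apply, Matrix.mul_apply, Finset.sum_eq_zero, rowMat, if_pos rfl, zero_add]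
        intro j _
        rw [h.row m le_rfl, zero_mul]
      rw [e]
      exact Lead.coord rowWt_zero (lead_zop m k)
    · have hlt : m < t := lt_of_le_of_ne (Nat.lt_succ_iff.1 hm) hmt
      rw [Matrix.add_apply, rowMat, if_neg hmt, add_zero, Matrix.mul_apply]
      refine Lead.sum (Finset.mem_univ k) ?_ fun j _ hj => ?_
      · have h1 := Lead.coord rowWt_zero (lead_lamOp_self t k)
        rw [Pi.single_zero] at h1
        have h2 := (h.y_lead m k hlt).mul blockWt_add h1
        rwa [add_zero] at h2
      · rw [Matrix.map_apply]
        rcases lt_or_gt_of_ne hj with hjk | hjk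
        · have h1 := ((h.y_lead m j hlt).degLe blockWt_add).mul
            (degLe_lamOp t j k).coord
          refine h1.mono ?_
          rw [blockWt_single, blockWt_single]
          have := cellWt_add_lt hlt hjk
          linarith
        · rw [lamOp_of_lt hjk, map_zero, mul_zero]
          exact DegLe.zero _

theorem exists_isBlock :
    ∃ Y L : Matrix (Fin n) (Fin n) (Op (Fin n → Fin n → ℕ)), IsBlock n Y L := by
  have h : ∀ t : ℕ, t ≤ n →
      ∃ Y L : Matrix (Fin n) (Fin n) (Op (Fin n → Fin n → ℕ)), IsBlock t Y L := by
    intro t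
    induction t with
    | zero => exact fun _ => ⟨0, 1, isBlock_zero⟩
    | succ t ih =>
      intro ht
      obtain ⟨Y, L, hYL⟩ := ih (by omega)
      exact ⟨_, _, IsBlock.succ (t := ⟨t, ht⟩) hYL⟩
  exact h n le_rfl

end Block

section Gluing

variable {ℓ n} {A : Type} [Ring A] [Algebra K A]

theorem BlockRel.l_y_swap {Y L : Matrix (Fin n) (Fin n) A} (h : BlockRel Y L) :
    m2 n A L * m1 n A Y = m1 n A Y * ext n A (Rm n) * m2 n A L := by
  ext p r
  have := congrFun (congrFun h.l_y p.swap) r.swap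
  rw [m1_mul_m2, m2_Rm21_m1] at this
  rw [m2_mul_m1, m1_Rm_m2]
  exact this

/-- Two matrices whose entries commute with each other. -/
def EntriesComm (M N : Matrix (Fin n) (Fin n) A) : Prop := ∀ i j k l, M i j * N k l = N k l * M i j

theorem EntriesComm.mul_left_comm {M N : Matrix (Fin n) (Fin n) A} (h : EntriesComm M N)
    (Z : Matrix (Idx n) (Idx n) A) : m1 n A M * (m2 n A N * Z) = m2 n A N * (m1 n A M * Z) := by
  rw [← mul_assoc, m1_commute_m2 h, mul_assoc]

/-- Blocks attached to the vertices of a cycle give a solution of the relations of `O_ℓ`. -/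
theorem isRep_of_blockRel (hl : 2 ≤ ℓ) {Y L : ZMod ℓ → Matrix (Fin n) (Fin n) A}
    (h : ∀ a, BlockRel (Y a) (L a)) (hYY : ∀ a b, a ≠ b → EntriesComm (Y a) (Y b))
    (hYL : ∀ a b, a ≠ b → EntriesComm (Y a) (L b)) (hLY : ∀ a b, a ≠ b → EntriesComm (L a) (Y b))
    (hLL : ∀ a b, a ≠ b → EntriesComm (L a) (L b)) :
    IsRep (fun a => L (a - 1) * Y a) := by
  have : Fact (1 < ℓ) := ⟨hl⟩
  have hsub : ∀ a : ZMod ℓ, a ≠ a - 1 := fun a ha => one_ne_zero (sub_eq_self.1 ha.symm)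
  constructor
  · intro a
    have hfrt := (frt_iff _).2 (h a).y_y
    have hll := (h (a - 1)).l_l
    simp only [m1_mul, m2_mul, mul_assoc] at hfrt hll ⊢
    rw [(hYL _ _ (hsub a)).mul_left_comm, ← mul_assoc (m1 n A (L _)),
      ← mul_assoc (ext n A _), hll]
    simp only [mul_assoc]
    rw [hfrt, (hLY _ _ (hsub a).symm).mul_left_comm]
  · intro h3 a
    have h2 : a ≠ a - 1 - 1 := by
      intro ha
      rw [sub_sub, one_add_one_eq_two, eq_comm, sub_eq_self] at ha
      have hdvd := (ZMod.natCast_eq_zero_iff 2 ℓ).1 (by exact_mod_cast ha)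
      exact absurd (Nat.le_of_dvd two_pos hdvd) (by omega)
    have hly := (h (a - 1)).l_y
    simp only [m1_mul, m2_mul, mul_assoc] at hly ⊢
    rw [(hYL _ _ h2).mul_left_comm, (hLL _ _ (hsub (a - 1))).mul_left_comm,
      m1_commute_m2 (hYY _ _ (hsub a)), ← mul_assoc (m1 n A (L _)) (m2 n A (Y _)), hly]
    simp only [mul_assoc]
  · rintro a b ⟨hba, hup, hdown⟩
    simp only [m1_mul, m2_mul, mul_assoc]
    rw [(hYL a (b - 1) fun e => hup (by rw [e, sub_add_cancel])).mul_left_comm,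
      (hLL (a - 1) (b - 1) fun e => hba (sub_left_injective e).symm).mul_left_comm,
      m1_commute_m2 (hYY a b hba.symm), (hLY (a - 1) b hdown.symm).mul_left_comm]
  · rintro rfl
    have e : ((1 + 1 : ZMod 2)) = 0 := by decide
    have h01 : (0 : ZMod 2) ≠ 1 := by decide
    have e' : (0 - 1 : ZMod 2) = 1 := by decide
    have hly := (h 1).l_y
    have hs := (h 0).l_y_swap
    simp only [e, e', sub_self, m1_mul, m2_mul, mul_assoc] at hly hs ⊢
    rw [← mul_assoc (ext n A _) (m2 n A (L 0)), ← mul_assoc (m1 n A (Y 0)), ← hs]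
    simp only [mul_assoc]
    rw [(hLL 1 0 h01.symm).mul_left_comm, m1_commute_m2 (hYY 0 1 h01),
      ← mul_assoc (m1 n A (L 1)), hly]
    simp only [mul_assoc]

end Gluing

section Representation

variable {ℓ n}

/-- The exponent of a generator. -/
def genExp (g : ZMod ℓ × Fin n × Fin n) : ZMod ℓ → Fin n → Fin n → ℕ :=
  Pi.single g.1 (Pi.single g.2.1 (unitOcc g.2.2))

theorem genExp_apply (g h : ZMod ℓ × Fin n × Fin n) :
    genExp g h.1 h.2.1 h.2.2 = if h = g then 1 else 0 := by
  obtain ⟨a, i, k⟩ := g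
  obtain ⟨b, j, l⟩ := h
  by_cases h1 : b = a
  · subst h1
    by_cases h2 : j = i
    · subst h2
      by_cases h3 : l = k
      · subst h3
        simp [genExp]
      · simp [genExp, h3]
    · simp [genExp, h2]
  · simp [genExp, h1]

theorem sum_genExp_apply (l : List (ZMod ℓ × Fin n × Fin n)) (g : ZMod ℓ × Fin n × Fin n) :
    (l.map genExp).sum g.1 g.2.1 g.2.2 = l.count g := by
  induction l with
  | nil => simp
  | cons h t ih =>
    rw [List.map_cons, List.sum_cons, Pi.add_apply, Pi.add_apply, Pi.add_apply, ih, genExp_apply,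
      List.count_cons, add_comm]
    congr 1
    simp only [beq_iff_eq, eq_comm (a := g)]

theorem perm_of_sum_genExp {l l' : List (ZMod ℓ × Fin n × Fin n)}
    (h : (l.map genExp).sum = (l'.map genExp).sum) : l.Perm l' := by
  rw [List.perm_iff_count]
  intro g
  rw [← sum_genExp_apply, ← sum_genExp_apply, h]

/-- The weight function on the representation space. -/
abbrev cycleWt [NeZero ℓ] : (ZMod ℓ → Fin n → Fin n → ℕ) → ℤ := totalWt fun _ => blockWt

theorem cycleWt_add [NeZero ℓ] (μ ν : ZMod ℓ → Fin n → Fin n → ℕ) :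
    cycleWt (μ + ν) = cycleWt μ + cycleWt ν := totalWt_add (fun _ => blockWt_add) μ ν

theorem cycleWt_genExp [NeZero ℓ] (a : ZMod ℓ) (i k : Fin n) :
    cycleWt (genExp (a, i, k)) = cellWt i k := by
  rw [genExp, cycleWt, totalWt_single fun _ => blockWt_zero, blockWt_single]

theorem exists_isRep [NeZero ℓ] (hl : 2 ≤ ℓ) :
    ∃ X : ZMod ℓ → Matrix (Fin n) (Fin n) (Op (ZMod ℓ → Fin n → Fin n → ℕ)),
      IsRep X ∧ ∀ g, Lead cycleWt (entry X g) (genExp g) := by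
  obtain ⟨Y, L, h⟩ := exists_isBlock (n := n)
  have hcomm : ∀ (M N : Matrix (Fin n) (Fin n) (Op (Fin n → Fin n → ℕ))) (a b : ZMod ℓ),
      a ≠ b → EntriesComm (A := Op (ZMod ℓ → Fin n → Fin n → ℕ)) (M.map (coord a))
        (N.map (coord b)) :=
    fun M N a b hab i j k l => coord_commute hab _ _
  have hrel : ∀ a : ZMod ℓ, BlockRel (A := Op (ZMod ℓ → Fin n → Fin n → ℕ)) (Y.map (coord a))
      (L.map (coord a)) := fun a =>
    BlockRel.map (B := Op (ZMod ℓ → Fin n → Fin n → ℕ)) h.rel (coord a)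
  refine ⟨_, isRep_of_blockRel hl hrel (hcomm Y Y) (hcomm Y L) (hcomm L Y) (hcomm L L), ?_⟩
  rintro ⟨a, i, k⟩
  have hy : ∀ m, Lead cycleWt (coord a (Y m k)) (genExp (a, m, k)) := fun m =>
    Lead.coord (w := fun _ : ZMod ℓ => blockWt) (fun _ => blockWt_zero) (h.y_lead m k m.2)
  simp only [entry]
  rw [Matrix.mul_apply]
  refine Lead.sum (Finset.mem_univ i) ?_ fun m _ hm => ?_
  · have h1 := Lead.coord (w := fun _ : ZMod ℓ => blockWt) (fun _ => blockWt_zero) (r := a - 1)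
      (h.l_diag i)
    rw [Pi.single_zero] at h1
    have h2 := h1.mul cycleWt_add (hy i)
    rwa [zero_add] at h2
  · rw [Matrix.map_apply, Matrix.map_apply]
    rcases lt_or_gt_of_ne hm with hm | hm
    · have h1 : DegLe cycleWt (coord (a - 1) (L i m)) 0 :=
        DegLe.coord (w := fun _ : ZMod ℓ => blockWt) (h.l_deg i m)
      refine (h1.mul ((hy m).degLe cycleWt_add)).mono ?_
      rw [cycleWt_genExp, cycleWt_genExp]
      have := cellWt_lt hm k
      linarith
    · rw [h.l_upper hm, map_zero, zero_mul]
      exact DegLe.zero _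

theorem noZeroDivisors_Ol (hl : 2 ≤ ℓ) : NoZeroDivisors (Ol ℓ n) := by
  have : NeZero ℓ := ⟨by omega⟩
  obtain ⟨X, hX, hlead⟩ := exists_isRep (n := n) hl
  refine noZeroDivisors_of_lead cycleWt_add hX.lift (span_ordered_words hl)
    (μ := fun m => (m.toList.map genExp).sum) ?_ fun m => ?_
  · intro m m' h
    rw [← Multiset.coe_toList m, ← Multiset.coe_toList m']
    exact Multiset.coe_eq_coe.2 (perm_of_sum_genExp h)
  · have e : hX.lift (m.toList.map (entry (Xm ℓ n))).prod = (m.toList.map (entry X)).prod := by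
      rw [map_list_prod, List.map_map]
      congr 1
      exact List.map_congr_left fun g _ => hX.lift_xg _ _ _
    rw [e]
    exact Lead.list_prod cycleWt_add hlead _

theorem detq_ne_zero (hl : 2 ≤ ℓ) (a : ZMod ℓ) : detq ℓ n a ≠ 0 := by
  have : NeZero ℓ := ⟨by omega⟩
  obtain ⟨X, hX, hlead⟩ := exists_isRep (n := n) hl
  intro h0
  have e : hX.lift (detq ℓ n a) = ∑ w : Equiv.Perm (Fin n), ((-qq) ^ len n w) •
      (((List.finRange n).map fun j => (a, w j, j)).map (entry X)).prod := by
    rw [detq, map_sum]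
    refine Finset.sum_congr rfl fun w _ => ?_
    rw [map_smul, map_list_prod, List.ofFn_eq_map, List.map_map, List.map_map]
    congr 2
    exact List.map_congr_left fun j _ => hX.lift_xg _ _ _
  refine Lead.sum_apply_ne_zero cycleWt_add (s := Finset.univ) Finset.univ_nonempty
    (μ := fun w : Equiv.Perm (Fin n) => (((List.finRange n).map fun j => (a, w j, j)).map
      genExp).sum) ?_ (fun w _ => Lead.list_prod cycleWt_add hlead _)
    (f := fun w => (-qq) ^ len n w) (fun w _ => pow_ne_zero _ (neg_ne_zero.2 qq_ne_zero))
    (v := bv 0) (by simp) ?_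
  · intro w _ w' _ h
    ext1 j
    have hj : (a, w j, j) ∈ (List.finRange n).map fun j => (a, w j, j) :=
      List.mem_map.2 ⟨j, List.mem_finRange j, rfl⟩
    rw [(perm_of_sum_genExp h).mem_iff, List.mem_map] at hj
    obtain ⟨k, -, hk⟩ := hj
    simp only [Prod.mk.injEq, true_and] at hk
    rw [← hk.1, hk.2]
  · rw [← e, h0, map_zero, LinearMap.zero_apply]

end Representation

/--
For `ℓ ≥ 2`, the multiplicative submonoid of `O_ℓ` generated by the FRT
quantum determinants `det_q(X^{(1)}), …, det_q(X^{(ℓ)})` consists of regular elements and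
satisfies both the left and the right Ore conditions.
-/
theorem statement_6 (hl : 2 ≤ ℓ) (hn : 1 ≤ n) :
    (∀ s ∈ Submonoid.closure (Set.range (detq ℓ n)), IsRegular s) ∧
    (∀ (a : Ol ℓ n), ∀ s ∈ Submonoid.closure (Set.range (detq ℓ n)),
        ∃ u ∈ Submonoid.closure (Set.range (detq ℓ n)), ∃ b : Ol ℓ n, u * a = b * s) ∧
    (∀ (a : Ol ℓ n), ∀ s ∈ Submonoid.closure (Set.range (detq ℓ n)),
        ∃ u ∈ Submonoid.closure (Set.range (detq ℓ n)), ∃ b : Ol ℓ n, a * u = s * b) := by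
  have := noZeroDivisors_Ol (n := n) hl
  have : IsCancelMulZero (Ol ℓ n) := NoZeroDivisors.to_isCancelMulZero _
  have hnormal : ∀ s ∈ Submonoid.closure (Set.range (detq ℓ n)), IsNormalElt s := fun s hs =>
    IsNormalElt.of_mem_closure (by rintro _ ⟨a, rfl⟩; exact isNormalElt_detq hl a) hs
  refine ⟨fun s hs => ?_, fun a s hs => ⟨s, hs, (hnormal s hs).1 a⟩,
    fun a s hs => ⟨s, hs, (hnormal s hs).2 a⟩⟩
  induction hs using Submonoid.closure_induction with
  | mem x hx =>
    obtain ⟨a, rfl⟩ := hx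
    exact IsRegular.of_ne_zero (detq_ne_zero hl a)
  | one => exact isRegular_one
  | mul x y _ _ hx hy => exact hx.mul hy

end Statement6
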